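/- arXiv:1209.6243 — 3 statements merged into one kernel-verified Lean document; each statement's English description precedes it below -/
import Mathlib

section
/- Let K be a field, (R, m) a parameter K-algebra, and M an R-module; set M_i := R_i ⊗_R M. The following conditions are equivalent: (i) M is flat over R and m-adically complete; (ii) there exists an m-adic system of R-modules {N_i}_{i∈ℕ} with each N_i flat over R_i, together with an isomorphism of R-modules M ≅ lim_i N_i; (iii) there exists a K-module V and an isomorphism of R-modules M ≅ R ⊗̂ V; (iv) M is m-adically complete, and for every K-linear map M_0 → M splitting the canonical surjection M → M_0, the induced R-linear homomorphism R ⊗̂ M_0 → M is bijective. -/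
universe u
open TensorProduct

section InverseLimit

variable {R : Type u} [CommRing R]
variable (N : ℕ → Type u) [∀ i, AddCommGroup (N i)] [∀ i, Module R (N i)]
variable (ψ : ∀ i, N (i + 1) →ₗ[R] N i)

/-- The inverse limit `lim_i N_i` of an inverse system of `R`-modules, realized as the
submodule of compatible families in the product. -/
def invLimit : Submodule R (∀ i, N i) where
  carrier := {f | ∀ i, ψ i (f (i + 1)) = f i}
  add_mem' := fun hf hg i => by simp only [Pi.add_apply, map_add]; rw [hf i, hg i]
  zero_mem' := fun i => by simp only [Pi.zero_apply, map_zero]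
  smul_mem' := fun r f hf i => by simp only [Pi.smul_apply, map_smul]; rw [hf i]

end InverseLimit

section Aux

variable (K : Type u) [Field K]
variable (R : Type u) [CommRing R] [Algebra K R] [IsLocalRing R] [IsNoetherianRing R]
variable (M : Type u) [AddCommGroup M] [Module R M]

/-- `M₀ := K ⊗_R M = M/𝔪M`, the reduction of `M` modulo the maximal ideal. -/
abbrev Mzero : Type u :=
  M ⧸ ((IsLocalRing.maximalIdeal R) • (⊤ : Submodule R M))

/-- `M₀` is a `K`-module (the maximal ideal kills it, and `R/𝔪 = K`);
we encode the `K`-action via the structure map `K → R`. -/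
noncomputable instance instModuleKMzero : Module K (Mzero R M) :=
  Module.compHom _ (algebraMap K R)

/-- The `R`-linear map `R ⊗_K M₀ → M` induced by a `K`-linear splitting
`σ : M₀ → M` of the canonical surjection `M → M₀`; it sends `r ⊗ x` to `r • σ(x)`. -/
noncomputable def inducedFromSplitting (σ : Mzero R M →+ M)
    (hσ : ∀ (k : K) (x : Mzero R M),
      σ ((algebraMap K R k) • x) = (algebraMap K R k) • σ x) :
    (R ⊗[K] (Mzero R M)) →ₗ[R] M where
  toFun := TensorProduct.liftAddHom
    { toFun := fun r =>
        { toFun := fun x => r • σ x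
          map_zero' := by simp
          map_add' := fun x y => by simp [smul_add] }
      map_zero' := by ext x; simp
      map_add' := fun r r' => by ext x; simp [add_smul] }
    (fun k r x => by
      show (k • r) • σ x = r • σ (k • x)
      have hx : σ (k • x) = (algebraMap K R k) • σ x := hσ k x
      rw [hx, Algebra.smul_def, mul_smul, smul_comm])
  map_add' := fun s t => by simp
  map_smul' := fun r t => by
    induction t using TensorProduct.induction_on with
    | zero => simp
    | tmul a x => simp [TensorProduct.smul_tmul', smul_eq_mul, mul_smul]
    | add a b ha hb =>
        simp only [smul_add, map_add]
        exact congrArg₂ (· + ·) ha hb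

end Aux

section BasisIdeal

variable {R P ι : Type*} [CommRing R] [AddCommGroup P] [Module R P]

theorem Module.Basis.mem_ideal_smul_top_iff (b : Module.Basis ι R P) (I : Ideal R) (x : P) :
    x ∈ I • (⊤ : Submodule R P) ↔ ∀ i, b.repr x i ∈ I := by
  constructor
  · intro hx i
    refine Submodule.smul_induction_on hx (fun r hr y _ => ?_) (fun y z hy hz => ?_)
    · simpa using I.mul_mem_right _ hr
    · simpa using I.add_mem hy hz
  · intro hx
    rw [← b.linearCombination_repr x, Finsupp.linearCombination_apply]
    exact Submodule.sum_mem _ fun i _ => Submodule.smul_mem_smul (hx i) Submodule.mem_top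

theorem Pi.mem_ideal_smul_top_iff [Finite ι] (I : Ideal R) (x : ι → R) :
    x ∈ I • (⊤ : Submodule R (ι → R)) ↔ ∀ i, x i ∈ I := by
  rw [(Pi.basisFun R ι).mem_ideal_smul_top_iff]
  simp only [Pi.basisFun_repr]

theorem Submodule.isTorsionBySet_quotient_smul_top (I : Ideal R) :
    Module.IsTorsionBySet R (P ⧸ I • (⊤ : Submodule R P)) (I : Set R) := by
  rintro x ⟨r, hr⟩
  obtain ⟨y, rfl⟩ := Submodule.Quotient.mk_surjective _ x
  exact (Submodule.Quotient.mk_eq_zero _).2 (Submodule.smul_mem_smul hr Submodule.mem_top)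

end BasisIdeal

section NullFunctions

variable {R : Type*} [CommRing R] (I : Ideal R) (ι : Type*)

/-- The functions `ι → R` tending to zero along the cofinite filter in the `I`-adic topology. -/
def nullFunctions : Submodule R (ι → R) where
  carrier := {x | ∀ n : ℕ, {i | x i ∉ I ^ n}.Finite}
  add_mem' {x y} hx hy n := ((hx n).union (hy n)).subset fun i hi => by
    by_contra h
    simp only [Set.mem_union, Set.mem_ofPred_eq, not_or, not_not] at h
    exact hi (Ideal.add_mem _ h.1 h.2)
  zero_mem' n := by simp
  smul_mem' r x hx n := (hx n).subset fun i hi h => hi (Ideal.mul_mem_left _ r h)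

variable {ι}

/-- A consequence of the Artin-Rees lemma: the solutions of a linear equation over a Noetherian
ring are combinations of finitely many solutions, with coefficients that are `I`-adically small
when the solution is. -/
theorem exists_generators_of_linear_relation [IsNoetherianRing R] [IsHausdorff I R] {l : ℕ}
    (f : Fin l → R) :
    ∃ (k c : ℕ) (g : Fin k → Fin l → R), (∀ j, ∑ i, f i * g j i = 0) ∧
      ∀ x : Fin l → R, ∑ i, f i * x i = 0 → ∃ y : Fin k → R, x = ∑ j, y j • g j ∧
        ∀ n, (∀ i, x i ∈ I ^ (n + c)) → ∀ j, y j ∈ I ^ n := by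
  let φ : (Fin l → R) →ₗ[R] R := Fintype.linearCombination R f
  have hφ (x : Fin l → R) : x ∈ LinearMap.ker φ ↔ ∑ i, f i * x i = 0 := by
    simp [φ, Fintype.linearCombination_apply, mul_comm]
  obtain ⟨k, g, hg⟩ := Submodule.fg_iff_exists_fin_generating_family.1
    (IsNoetherian.noetherian (LinearMap.ker φ))
  obtain ⟨c, hc⟩ := I.exists_pow_inf_eq_pow_smul (LinearMap.ker φ)
  have key (n : ℕ) (x : Fin l → R) (hx : x ∈ LinearMap.ker φ) (hn : ∀ i, x i ∈ I ^ (n + c)) :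
      ∃ y : Fin k → R, x = ∑ j, y j • g j ∧ ∀ j, y j ∈ I ^ n := by
    have h1 : x ∈ I ^ n • Submodule.span R (Set.range g) := by
      have h2 : x ∈ I ^ (n + c) • ⊤ ⊓ LinearMap.ker φ :=
        ⟨(Pi.mem_ideal_smul_top_iff _ _).2 hn, hx⟩
      rw [hc _ (Nat.le_add_left c n), Nat.add_sub_cancel] at h2
      rw [hg]
      exact Submodule.smul_mono le_rfl inf_le_right h2
    obtain ⟨a, ha, hax⟩ := (Submodule.mem_ideal_smul_span_iff_exists_sum _ _ _).1 h1
    exact ⟨a, by rw [← hax, Finsupp.sum_fintype _ _ (by simp)], ha⟩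
  refine ⟨k, c, g, fun j => (hφ _).1 (hg ▸ Submodule.subset_span ⟨j, rfl⟩), fun x hx => ?_⟩
  rw [← hφ] at hx
  classical
  by_cases hex : ∃ n, ¬ ∀ i, x i ∈ I ^ (n + c)
  · rcases hm : Nat.find hex with _ | m
    · obtain ⟨a, ha, hax⟩ := (Submodule.mem_ideal_smul_span_iff_exists_sum ⊤ g x).1
        (by rw [hg, Submodule.top_smul]; exact hx)
      refine ⟨a, by rw [← hax, Finsupp.sum_fintype _ _ (by simp)], fun n hn => ?_⟩
      refine absurd (fun i => Ideal.pow_le_pow_right ?_ (hn i)) (Nat.find_spec hex)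
      omega
    · obtain ⟨y, hy, hym⟩ := key m x hx (not_not.1 (Nat.find_min hex (by omega)))
      refine ⟨y, hy, fun n hn j => Ideal.pow_le_pow_right ?_ (hym j)⟩
      by_contra! h
      refine Nat.find_spec hex fun i => Ideal.pow_le_pow_right ?_ (hn i)
      omega
  · push Not at hex
    have hx0 : x = 0 := funext fun i => IsHausdorff.haus (I := I) ‹_› _ fun n => by
      rw [SModEq.zero, smul_eq_mul, Ideal.mul_top]
      exact Ideal.pow_le_pow_right (Nat.le_add_right n c) (hex n i)
    exact ⟨0, by simp [hx0], fun n _ j => zero_mem _⟩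

theorem nullFunctions_flat [IsNoetherianRing R] [IsHausdorff I R] :
    Module.Flat R (nullFunctions I ι) := by
  rw [Module.Flat.iff_forall_isTrivialRelation]
  intro l f x hfx
  obtain ⟨k, c, g, hg, h⟩ := exists_generators_of_linear_relation I f
  have hx (b : ι) : ∑ i, f i * (x i : ι → R) b = 0 := by
    simpa using congrFun (congrArg Subtype.val hfx) b
  choose y hy hyn using fun b => h (fun i => (x i : ι → R) b) (hx b)
  refine ⟨k, fun i j => g j i, fun j => ⟨fun b => y b j, fun n => ?_⟩, fun i => ?_, hg⟩
  · refine (Set.finite_iUnion fun i => (x i).2 (n + c)).subset fun b hb => ?_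
    by_contra hcon
    simp only [Set.mem_iUnion, Set.mem_ofPred_eq, not_exists, not_not] at hcon
    exact hb (hyn b n hcon j)
  · ext b
    simpa [mul_comm] using congrFun (hy b) i

end NullFunctions

section Coordinates

variable {R P ι : Type*} [CommRing R] [AddCommGroup P] [Module R P] (I : Ideal R)
  [IsAdicComplete I R] (b : Module.Basis ι R P)

/-- The coordinates of an element of the completion of a free module over a complete ring. -/
noncomputable def AdicCompletion.coords : AdicCompletion I P →ₗ[R] ι → R :=
  LinearMap.pi fun i => (AdicCompletion.ofLinearEquiv I R).symm.toLinearMap ∘ₗ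
    (AdicCompletion.map I (b.coord i)).restrictScalars R

theorem AdicCompletion.coords_mk_sub_mem (a : AdicCompletion.AdicCauchySequence I P) (i : ι)
    (n : ℕ) : AdicCompletion.coords I b (AdicCompletion.mk I P a) i - b.repr (a n) i ∈ I ^ n := by
  have h : AdicCompletion.of I R (AdicCompletion.coords I b (AdicCompletion.mk I P a) i) =
      AdicCompletion.map I (b.coord i) (AdicCompletion.mk I P a) :=
    AdicCompletion.of_ofLinearEquiv_symm I _
  rw [AdicCompletion.map_mk] at h
  have h2 := (Submodule.Quotient.eq _).1 (congrArg (AdicCompletion.eval I R n) h)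
  rwa [smul_eq_mul, Ideal.mul_top] at h2

theorem AdicCompletion.coords_injective : Function.Injective (AdicCompletion.coords I b) := by
  rw [injective_iff_map_eq_zero]
  intro x hx
  obtain ⟨a, rfl⟩ := AdicCompletion.mk_surjective I P x
  ext n
  simp only [AdicCompletion.mk_apply_coe, Submodule.mkQ_apply, AdicCompletion.val_zero_apply,
    Submodule.Quotient.mk_eq_zero]
  rw [b.mem_ideal_smul_top_iff]
  intro i
  simpa [hx] using AdicCompletion.coords_mk_sub_mem I b a i n

theorem AdicCompletion.range_coords :
    LinearMap.range (AdicCompletion.coords I b) = nullFunctions I ι := by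
  ext x
  constructor
  · rintro ⟨y, rfl⟩ n
    obtain ⟨a, rfl⟩ := AdicCompletion.mk_surjective I P y
    refine (b.repr (a n)).support.finite_toSet.subset fun i hi => ?_
    by_contra h
    have h0 : b.repr (a n) i = 0 := by simpa using h
    exact hi (by simpa [h0] using AdicCompletion.coords_mk_sub_mem I b a i n)
  · intro hx
    classical
    let s (n : ℕ) : ι →₀ R := Finsupp.onFinset (hx n).toFinset
      (fun i => if x i ∈ I ^ n then 0 else x i) fun i hi => by
        simpa using fun h => hi (if_pos h)
    have hs (n : ℕ) (i : ι) : x i - s n i ∈ I ^ n := by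
      by_cases h : x i ∈ I ^ n <;> simp [s, h]
    let a : AdicCompletion.AdicCauchySequence I P :=
      AdicCompletion.AdicCauchySequence.mk I P (fun n => b.repr.symm (s n)) fun n => by
        rw [SModEq.sub_mem, b.mem_ideal_smul_top_iff]
        intro i
        have := Ideal.sub_mem _ (Ideal.pow_le_pow_right n.le_succ (hs (n + 1) i)) (hs n i)
        simpa using this
    refine ⟨AdicCompletion.mk I P a, funext fun i => ?_⟩
    rw [IsHausdorff.eq_iff_smodEq (I := I)]
    intro n
    rw [SModEq.sub_mem, smul_eq_mul, Ideal.mul_top]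
    have h := Ideal.sub_mem _ (AdicCompletion.coords_mk_sub_mem I b a i n) (hs n i)
    simpa [a] using h

include b in
theorem AdicCompletion.flat_of_basis [IsNoetherianRing R] :
    Module.Flat R (AdicCompletion I P) :=
  have := nullFunctions_flat I (ι := ι)
  .of_linearEquiv ((LinearEquiv.ofInjective _ (AdicCompletion.coords_injective I b)).trans
    (LinearEquiv.ofEq _ _ (AdicCompletion.range_coords I b)))

end Coordinates

section FlatModPower

open IsLocalRing

theorem IsLocalRing.linearIndependent_of_flat_of_mem_maximalIdeal {S N ι : Type u} [CommRing S]
    [IsLocalRing S] [AddCommGroup N] [Module S N] [Module.Flat S N] (v : ι → N)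
    (h : ∀ c : ι →₀ S, Finsupp.linearCombination S v c ∈ maximalIdeal S • (⊤ : Submodule S N) →
      ∀ i, c i ∈ maximalIdeal S) : LinearIndependent S v := by
  refine Module.IsLocalRing.linearIndependent_of_flat v ?_
  rw [linearIndependent_iff]
  intro c hc
  obtain ⟨d, rfl⟩ := Finsupp.mapRange_surjective (α := ι) (residue S) (map_zero _)
    residue_surjective c
  have hd : (Finsupp.linearCombination (ResidueField S)
        (TensorProduct.mk S (ResidueField S) N 1 ∘ v)) (d.mapRange (residue S) (map_zero _)) =
      TensorProduct.mk S (ResidueField S) N 1 (Finsupp.linearCombination S v d) := by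
    rw [Finsupp.linearCombination_apply, Finsupp.sum_mapRange_index (by simp),
      Finsupp.linearCombination_apply, map_finsuppSum]
    refine Finsupp.sum_congr fun i _ => ?_
    rw [map_smul]
    rfl
  rw [hd, ← LinearMap.mem_ker] at hc
  have hker : LinearMap.ker (TensorProduct.mk S (ResidueField S) N 1) =
      maximalIdeal S • (⊤ : Submodule S N) := LinearMap.ker_tensorProductMk _
  rw [hker] at hc
  ext i
  simpa using (residue_eq_zero_iff _).2 (h d hc i)

variable {R : Type u} [CommRing R] [IsLocalRing R]

theorem mem_of_linearCombination_eq_zero_of_flat_quotient {N ι : Type u} [AddCommGroup N]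
    [Module R N] {I : Ideal R} (hI : I ≤ maximalIdeal R)
    (htor : Module.IsTorsionBySet R N (I : Set R))
    (hflat : @Module.Flat (R ⧸ I) N _ _ htor.module) (v : ι → N)
    (h : ∀ c : ι →₀ R, Finsupp.linearCombination R v c ∈ maximalIdeal R • (⊤ : Submodule R N) →
      ∀ i, c i ∈ maximalIdeal R)
    (c : ι →₀ R) (hc : Finsupp.linearCombination R v c = 0) (i : ι) : c i ∈ I := by
  let _ : Module (R ⧸ I) N := htor.module
  have : Nontrivial (R ⧸ I) := Ideal.Quotient.nontrivial_iff.2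
    (hI.trans_lt (maximalIdeal.isMaximal R).lt_top).ne
  have : IsLocalRing (R ⧸ I) :=
    .of_surjective' (Ideal.Quotient.mk I) Ideal.Quotient.mk_surjective
  have hmem (r : R) : Ideal.Quotient.mk I r ∈ maximalIdeal (R ⧸ I) ↔ r ∈ maximalIdeal R := by
    have : IsLocalHom (Ideal.Quotient.mk I) :=
      .of_surjective _ Ideal.Quotient.mk_surjective
    simp only [mem_maximalIdeal, mem_nonunits_iff, isUnit_map_iff]
  have hlin (d : ι →₀ R) : Finsupp.linearCombination (R ⧸ I) v
      (d.mapRange (Ideal.Quotient.mk I) (map_zero _)) = Finsupp.linearCombination R v d := by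
    rw [Finsupp.linearCombination_apply, Finsupp.sum_mapRange_index (by simp),
      Finsupp.linearCombination_apply]
    rfl
  have hli : LinearIndependent (R ⧸ I) v := by
    refine IsLocalRing.linearIndependent_of_flat_of_mem_maximalIdeal v fun c hc i => ?_
    obtain ⟨d, rfl⟩ := Finsupp.mapRange_surjective (α := ι) (Ideal.Quotient.mk I) (map_zero _)
      Ideal.Quotient.mk_surjective c
    rw [hlin] at hc
    rw [Finsupp.mapRange_apply, hmem]
    refine h d (Submodule.smul_induction_on hc (fun r hr y _ => ?_)
      fun y z hy hz => Submodule.add_mem _ hy hz) i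
    obtain ⟨r, rfl⟩ := Ideal.Quotient.mk_surjective r
    exact Submodule.smul_mem_smul ((hmem r).1 hr) Submodule.mem_top
  have h0 := linearIndependent_iff.1 hli _ ((hlin c).trans hc)
  simpa [Ideal.Quotient.eq_zero_iff_mem] using DFunLike.congr_fun h0 i

theorem ker_eq_smul_top_of_flat_quotient {P N : Type u} [AddCommGroup P] [Module R P]
    [Module.Free R P] [AddCommGroup N] [Module R N] {I : Ideal R} (hI : I ≤ maximalIdeal R)
    (htor : Module.IsTorsionBySet R N (I : Set R))
    (hflat : @Module.Flat (R ⧸ I) N _ _ htor.module) (f : P →ₗ[R] N)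
    (hf : ∀ x, f x ∈ maximalIdeal R • (⊤ : Submodule R N) →
      x ∈ maximalIdeal R • (⊤ : Submodule R P)) :
    LinearMap.ker f = I • (⊤ : Submodule R P) := by
  let b := Module.Free.chooseBasis R P
  have hb (c : Module.Free.ChooseBasisIndex R P →₀ R) :
      Finsupp.linearCombination R (f ∘ b) c = f (b.repr.symm c) := by
    rw [b.repr_symm_apply, ← Finsupp.apply_linearCombination]
  refine le_antisymm (fun x hx => ?_) (Submodule.smul_le.2 fun r hr y _ => ?_)
  · rw [b.mem_ideal_smul_top_iff]
    refine mem_of_linearCombination_eq_zero_of_flat_quotient hI htor hflat (f ∘ b)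
      (fun c hc i => ?_) _ (by simpa [hb] using hx)
    rw [hb] at hc
    simpa using (b.mem_ideal_smul_top_iff _ _).1 (hf _ hc) i
  · rw [LinearMap.mem_ker, map_smul]
    exact @htor (f y) ⟨r, hr⟩

omit [IsLocalRing R] in
theorem flat_quotient_smul_top {N : Type u} [AddCommGroup N] [Module R N] [Module.Flat R N]
    (I : Ideal R) (htor : Module.IsTorsionBySet R (N ⧸ I • (⊤ : Submodule R N)) (I : Set R)) :
    @Module.Flat (R ⧸ I) (N ⧸ I • (⊤ : Submodule R N)) _ _ htor.module := by
  let _ : Module (R ⧸ I) (N ⧸ I • (⊤ : Submodule R N)) := htor.module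
  have : IsScalarTower R (R ⧸ I) (N ⧸ I • (⊤ : Submodule R N)) := htor.isScalarTower
  exact .of_linearEquiv ((TensorProduct.quotTensorEquivQuotSMul N I).symm.extendScalarsOfSurjective
    Ideal.Quotient.mk_surjective)

end FlatModPower

section Residue

open IsLocalRing

variable {K R : Type*} [Field K] [CommRing R] [Algebra K R] [IsLocalRing R]

theorem exists_sub_one_tmul_mem_maximalIdeal_smul
    (hres : Function.Surjective (algebraMap K (ResidueField R)))
    {V : Type*} [AddCommGroup V] [Module K V] (x : R ⊗[K] V) :
    ∃ v : V, x - 1 ⊗ₜ[K] v ∈ maximalIdeal R • (⊤ : Submodule R (R ⊗[K] V)) := by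
  induction x using TensorProduct.induction_on with
  | zero => exact ⟨0, by simp⟩
  | tmul r v =>
    obtain ⟨k, hk⟩ := hres (residue R r)
    refine ⟨k • v, ?_⟩
    have h : r ⊗ₜ[K] v - 1 ⊗ₜ[K] (k • v) = (r - algebraMap K R k) • ((1 : R) ⊗ₜ[K] v) := by
      rw [sub_smul r (algebraMap K R k) ((1 : R) ⊗ₜ[K] v), TensorProduct.tmul_smul,
        algebraMap_smul, TensorProduct.smul_tmul' r, smul_eq_mul, mul_one]
    rw [h]
    refine Submodule.smul_mem_smul ((residue_eq_zero_iff _).1 ?_) Submodule.mem_top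
    rw [map_sub, ← hk, sub_eq_zero]
    rfl
  | add x y hx hy =>
    obtain ⟨v, hv⟩ := hx
    obtain ⟨w, hw⟩ := hy
    refine ⟨v + w, ?_⟩
    rw [TensorProduct.tmul_add, add_sub_add_comm]
    exact Submodule.add_mem _ hv hw

theorem mem_maximalIdeal_smul_of_map_mem
    (hres : Function.Surjective (algebraMap K (ResidueField R)))
    {V N : Type*} [AddCommGroup V] [Module K V] [AddCommGroup N] [Module R N]
    (f : R ⊗[K] V →ₗ[R] N)
    (hf : ∀ v : V, f (1 ⊗ₜ v) ∈ maximalIdeal R • (⊤ : Submodule R N) → v = 0)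
    (x : R ⊗[K] V) (hx : f x ∈ maximalIdeal R • (⊤ : Submodule R N)) :
    x ∈ maximalIdeal R • (⊤ : Submodule R (R ⊗[K] V)) := by
  obtain ⟨v, hv⟩ := exists_sub_one_tmul_mem_maximalIdeal_smul hres x
  have h := Submodule.smul_top_le_comap_smul_top _ f hv
  rw [Submodule.mem_comap, map_sub] at h
  have h0 := hf v (by simpa using Submodule.sub_mem _ hx h)
  simpa [h0] using hv

theorem range_eq_top_of_range_sup_smul_eq_top {R P N : Type*} [CommRing R] [AddCommGroup P]
    [Module R P] [AddCommGroup N] [Module R N] (f : P →ₗ[R] N) {I : Ideal R} {n : ℕ}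
    (htor : Module.IsTorsionBySet R N ((I ^ n : Ideal R) : Set R))
    (h : LinearMap.range f ⊔ I • ⊤ = ⊤) : LinearMap.range f = ⊤ := by
  have key (k : ℕ) : LinearMap.range f ⊔ I ^ k • ⊤ = ⊤ := by
    induction k with
    | zero => simp
    | succ k ih =>
      have h1 : I ^ k • (⊤ : Submodule R N) ≤ LinearMap.range f ⊔ I ^ (k + 1) • ⊤ := by
        conv_lhs => rw [← h]
        rw [Submodule.smul_sup, pow_succ, Submodule.mul_smul]
        exact sup_le_sup_right Submodule.smul_le_right _
      exact top_le_iff.1 (ih.ge.trans (sup_le le_sup_left h1))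
  have h0 : I ^ n • (⊤ : Submodule R N) = ⊥ :=
    eq_bot_iff.2 (Submodule.smul_le.2 fun r hr x _ => @htor x ⟨r, hr⟩)
  simpa [h0] using key n

end Residue

section InvLimitComparison

variable {R : Type u} [CommRing R] {I : Ideal R} {P : Type u} [AddCommGroup P] [Module R P]
  {N : ℕ → Type u} [∀ i, AddCommGroup (N i)] [∀ i, Module R (N i)]
  {ψ : ∀ i, N (i + 1) →ₗ[R] N i}

theorem nonempty_adicCompletion_linearEquiv_invLimit (f : ∀ i, P →ₗ[R] N i)
    (hψ : ∀ i, ψ i ∘ₗ f (i + 1) = f i) (hsurj : ∀ i, Function.Surjective (f i))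
    (hker : ∀ i, LinearMap.ker (f i) = I ^ (i + 1) • (⊤ : Submodule R P)) :
    Nonempty (AdicCompletion I P ≃ₗ[R] invLimit N ψ) := by
  have hψ' (i : ℕ) (x : P) : ψ i (f (i + 1) x) = f i x := LinearMap.congr_fun (hψ i) x
  let g : AdicCompletion I P →ₗ[R] ∀ i, N i := LinearMap.pi fun i =>
    (I ^ (i + 1) • (⊤ : Submodule R P)).liftQ (f i) (hker i).ge ∘ₗ AdicCompletion.eval I P (i + 1)
  have hg (a : AdicCompletion.AdicCauchySequence I P) (i : ℕ) :
      g (AdicCompletion.mk I P a) i = f i (a (i + 1)) := rfl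
  have hstep (a : AdicCompletion.AdicCauchySequence I P) (i : ℕ) :
      f i (a (i + 1 + 1)) = f i (a (i + 1)) := by
    rw [← sub_eq_zero, ← map_sub, ← LinearMap.mem_ker, hker, ← SModEq.sub_mem]
    exact (a.2 (Nat.le_succ (i + 1))).symm
  have hmem (x : AdicCompletion I P) : g x ∈ invLimit N ψ := by
    obtain ⟨a, rfl⟩ := AdicCompletion.mk_surjective I P x
    intro i
    rw [hg, hg, hψ', hstep]
  refine ⟨LinearEquiv.ofBijective (g.codRestrict _ hmem) ⟨?_, ?_⟩⟩
  · rw [← LinearMap.ker_eq_bot, LinearMap.ker_codRestrict, LinearMap.ker_eq_bot,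
      injective_iff_map_eq_zero]
    intro x hx
    obtain ⟨a, rfl⟩ := AdicCompletion.mk_surjective I P x
    refine AdicCompletion.mk_zero_of I P a ⟨0, fun n _ => ⟨n + 1, n.le_succ, n + 1, n.le_succ, ?_⟩⟩
    rw [← hker, LinearMap.mem_ker, ← hg, hx, Pi.zero_apply]
  · rintro ⟨y, hy⟩
    choose p hp using fun i => hsurj i (y i)
    refine ⟨AdicCompletion.mk I P (AdicCompletion.AdicCauchySequence.mk I P p fun n => ?_),
      Subtype.ext (funext fun i => ?_)⟩
    · refine SModEq.mono (Submodule.smul_mono_left (Ideal.pow_le_pow_right n.le_succ)) ?_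
      rw [SModEq.sub_mem, ← hker, LinearMap.mem_ker, map_sub, sub_eq_zero, hp, ← hψ', hp]
      exact (hy n).symm
    · change f i (p (i + 1)) = y i
      rw [← hψ', hp]
      exact hy i

end InvLimitComparison

section MainImplications

open IsLocalRing

variable {K : Type u} [Field K] {R : Type u} [CommRing R] [Algebra K R]

theorem AdicCompletion.isAdicComplete_of_linearEquiv {R M P : Type*} [CommRing R] [AddCommGroup M]
    [Module R M] [AddCommGroup P] [Module R P] {I : Ideal R} (hI : I.FG)
    (e : M ≃ₗ[R] AdicCompletion I P) : IsAdicComplete I M := by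
  have := AdicCompletion.isAdicComplete (M := P) hI
  rw [← AdicCompletion.of_bijective_iff]
  have h : AdicCompletion.congr I e ∘ AdicCompletion.of I M =
      AdicCompletion.of I (AdicCompletion I P) ∘ e := by
    ext1 x
    rw [Function.comp_apply, Function.comp_apply, AdicCompletion.congr_apply,
      AdicCompletion.map_of, LinearEquiv.coe_coe]
  have h2 := (AdicCompletion.of_bijective I (AdicCompletion I P)).comp e.bijective
  rw [← h] at h2
  exact (Function.Bijective.of_comp_iff' (AdicCompletion.congr I e).bijective _).1 h2

theorem exists_adic_system_of_flat {M : Type u} [AddCommGroup M] [Module R M] (I : Ideal R)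
    [Module.Flat R M] [IsAdicComplete I M] :
    ∃ (N : ℕ → Type u) (_ : ∀ i, AddCommGroup (N i)) (_ : ∀ i, Module R (N i))
        (htor : ∀ i, Module.IsTorsionBySet R (N i) ((I ^ (i + 1) : Ideal R) : Set R))
        (ψ : ∀ i, N (i + 1) →ₗ[R] N i),
      (∀ i, Function.Surjective (ψ i)) ∧
      (∀ i, LinearMap.ker (ψ i) = (I ^ (i + 1)) • (⊤ : Submodule R (N (i + 1)))) ∧
      (∀ i, @Module.Flat (R ⧸ (I ^ (i + 1))) (N i) _ _ ((htor i).module)) ∧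
      Nonempty (M ≃ₗ[R] invLimit N ψ) := by
  let ψ (i : ℕ) : (M ⧸ I ^ (i + 1 + 1) • (⊤ : Submodule R M)) →ₗ[R]
      M ⧸ I ^ (i + 1) • (⊤ : Submodule R M) :=
    Submodule.liftQ _ (Submodule.mkQ _) (by
      rw [Submodule.ker_mkQ]
      exact Submodule.smul_mono_left (Ideal.pow_le_pow_right (Nat.le_succ _)))
  refine ⟨fun i => M ⧸ I ^ (i + 1) • (⊤ : Submodule R M), fun i => inferInstance,
    fun i => inferInstance, fun i => Submodule.isTorsionBySet_quotient_smul_top _, ψ,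
    fun i => ?_, fun i => ?_, fun i => flat_quotient_smul_top _ _, ?_⟩
  · intro x
    obtain ⟨y, rfl⟩ := Submodule.mkQ_surjective _ x
    exact ⟨Submodule.mkQ _ y, rfl⟩
  · rw [Submodule.ker_liftQ, Submodule.ker_mkQ, Submodule.map_smul'', Submodule.map_top,
      Submodule.range_mkQ]
  · obtain ⟨e⟩ := nonempty_adicCompletion_linearEquiv_invLimit (I := I) (ψ := ψ)
      (fun i => Submodule.mkQ _) (fun i => rfl) (fun i => Submodule.mkQ_surjective _)
      (fun i => Submodule.ker_mkQ _)
    exact ⟨(AdicCompletion.ofLinearEquiv I M).trans e⟩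

theorem invLimit_proj_surjective {N : ℕ → Type u} [∀ i, AddCommGroup (N i)]
    [∀ i, Module R (N i)] {ψ : ∀ i, N (i + 1) →ₗ[R] N i}
    (hψ : ∀ i, Function.Surjective (ψ i)) :
    Function.Surjective (LinearMap.proj 0 ∘ₗ (invLimit N ψ).subtype) := by
  intro x
  choose s hs using hψ
  exact ⟨⟨fun i => Nat.rec x (fun i y => s i y) i, fun i => hs i _⟩, rfl⟩

variable [IsLocalRing R]

theorem exists_linearEquiv_adicCompletion_of_adic_system
    (hres : Function.Surjective (algebraMap K (ResidueField R)))
    {N : ℕ → Type u} [∀ i, AddCommGroup (N i)] [∀ i, Module R (N i)]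
    (htor : ∀ i, Module.IsTorsionBySet R (N i) ((maximalIdeal R ^ (i + 1) : Ideal R) : Set R))
    {ψ : ∀ i, N (i + 1) →ₗ[R] N i} (hsurj : ∀ i, Function.Surjective (ψ i))
    (hker : ∀ i, LinearMap.ker (ψ i) =
      (maximalIdeal R ^ (i + 1)) • (⊤ : Submodule R (N (i + 1))))
    (hflat : ∀ i, @Module.Flat (R ⧸ (maximalIdeal R ^ (i + 1))) (N i) _ _ ((htor i).module)) :
    ∃ (V : Type u) (_ : AddCommGroup V) (_ : Module K V),
      Nonempty (invLimit N ψ ≃ₗ[R] AdicCompletion (maximalIdeal R) (R ⊗[K] V)) := by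
  let _ (i : ℕ) : Module K (N i) := Module.compHom _ (algebraMap K R)
  have (i : ℕ) : IsScalarTower K R (N i) := IsScalarTower.of_algebraMap_smul fun _ _ => rfl
  let p (i : ℕ) : invLimit N ψ →ₗ[R] N i := LinearMap.proj i ∘ₗ (invLimit N ψ).subtype
  have hp (i : ℕ) : ψ i ∘ₗ p (i + 1) = p i := LinearMap.ext fun x => x.2 i
  obtain ⟨σ, hσ⟩ := LinearMap.exists_rightInverse_of_surjective ((p 0).restrictScalars K)
    (LinearMap.range_eq_top.2 (invLimit_proj_surjective hsurj))
  let F : R ⊗[K] N 0 →ₗ[R] invLimit N ψ := σ.liftBaseChange R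
  let f (i : ℕ) : R ⊗[K] N 0 →ₗ[R] N i := p i ∘ₗ F
  have hf (i : ℕ) : ψ i ∘ₗ f (i + 1) = f i := by rw [← LinearMap.comp_assoc, hp]
  have hf0 (v : N 0) : f 0 (1 ⊗ₜ v) = v := by
    simpa [f, F] using LinearMap.congr_fun hσ v
  have hN0 : maximalIdeal R • (⊤ : Submodule R (N 0)) = ⊥ :=
    eq_bot_iff.2 (Submodule.smul_le.2 fun r hr x _ =>
      @htor 0 x ⟨r, by simpa using hr⟩)
  have hmem0 (x : R ⊗[K] N 0) (hx : f 0 x = 0) :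
      x ∈ maximalIdeal R • (⊤ : Submodule R (R ⊗[K] N 0)) := by
    refine mem_maximalIdeal_smul_of_map_mem hres (f 0) (fun v hv => ?_) x (by simp [hx])
    simpa [hN0, hf0] using hv
  have hstep (i : ℕ) (y : N (i + 1)) (hy : y ∈ maximalIdeal R • (⊤ : Submodule R (N (i + 1)))) :
      ψ i y ∈ maximalIdeal R • (⊤ : Submodule R (N i)) := Submodule.smul_top_le_comap_smul_top _ _ hy
  have hmem (i : ℕ) (x : R ⊗[K] N 0) (hx : f i x ∈ maximalIdeal R • (⊤ : Submodule R (N i))) :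
      x ∈ maximalIdeal R • (⊤ : Submodule R (R ⊗[K] N 0)) := by
    induction i with
    | zero => exact hmem0 x (by simpa [hN0] using hx)
    | succ i ih => exact ih (by rw [← hf]; exact hstep i _ hx)
  have hrange (i : ℕ) : LinearMap.range (f i) ⊔ maximalIdeal R • ⊤ = ⊤ := by
    induction i with
    | zero =>
      rw [LinearMap.range_eq_top.2 fun v => ⟨_, hf0 v⟩, top_sup_eq]
    | succ i ih =>
      rw [eq_top_iff]
      intro y _
      obtain ⟨x, hx⟩ : ∃ x, f i x = ψ i y :=
        LinearMap.range_eq_top.1 (range_eq_top_of_range_sup_smul_eq_top (f i) (htor i) ih) _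
      have hy : y - f (i + 1) x ∈ LinearMap.ker (ψ i) := by
        rw [LinearMap.mem_ker, map_sub, ← hx, ← hf]
        simp
      rw [hker] at hy
      rw [← add_sub_cancel (f (i + 1) x) y]
      exact Submodule.add_mem_sup ⟨x, rfl⟩
        (Submodule.smul_mono_left (Ideal.pow_le_self i.succ_ne_zero) hy)
  obtain ⟨e⟩ := nonempty_adicCompletion_linearEquiv_invLimit f hf
    (fun i => LinearMap.range_eq_top.1
      (range_eq_top_of_range_sup_smul_eq_top (f i) (htor i) (hrange i)))
    (fun i => ker_eq_smul_top_of_flat_quotient (Ideal.pow_le_self i.succ_ne_zero) (htor i)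
      (hflat i) (f i) (hmem i))
  exact ⟨N 0, inferInstance, inferInstance, ⟨e.symm⟩⟩

theorem AdicCompletion.map_bijective_of_flat {P M : Type u} [AddCommGroup P] [Module R P]
    [Module.Free R P] [AddCommGroup M] [Module R M] [Module.Flat R M] (f : P →ₗ[R] M)
    (hf : ∀ x, f x ∈ maximalIdeal R • (⊤ : Submodule R M) →
      x ∈ maximalIdeal R • (⊤ : Submodule R P))
    (hsurj : Function.Surjective (Submodule.mkQ (maximalIdeal R • ⊤) ∘ₗ f)) :
    Function.Bijective (AdicCompletion.map (maximalIdeal R) f) := by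
  refine ⟨?_, AdicCompletion.map_surjective_of_mkQ_comp_surjective hsurj⟩
  rw [injective_iff_map_eq_zero]
  intro x hx
  obtain ⟨a, rfl⟩ := AdicCompletion.mk_surjective _ _ x
  refine AdicCompletion.mk_zero_of _ _ a ⟨1, fun n hn => ⟨n, le_rfl, n, le_rfl, ?_⟩⟩
  have hI : maximalIdeal R ^ n ≤ maximalIdeal R := Ideal.pow_le_self (by omega)
  have htor := Submodule.isTorsionBySet_quotient_smul_top (P := M) (maximalIdeal R ^ n)
  have hle : maximalIdeal R ^ n • (⊤ : Submodule R M) ≤ maximalIdeal R • ⊤ :=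
    Submodule.smul_mono_left hI
  rw [← ker_eq_smul_top_of_flat_quotient hI htor (flat_quotient_smul_top _ htor)
    (Submodule.mkQ _ ∘ₗ f) fun y hy => hf y ?_]
  · rw [AdicCompletion.map_mk] at hx
    exact congrArg (AdicCompletion.eval _ M n) hx
  · have h : maximalIdeal R • (⊤ : Submodule R (M ⧸ maximalIdeal R ^ n • (⊤ : Submodule R M))) =
        (maximalIdeal R • ⊤ : Submodule R M).map (Submodule.mkQ _) := by
      rw [Submodule.map_smul'', Submodule.map_top, Submodule.range_mkQ]
    rw [h, LinearMap.comp_apply, ← Submodule.mem_comap, Submodule.comap_map_mkQ,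
      sup_eq_right.2 hle] at hy
    exact hy

theorem inducedFromSplitting_tmul {M : Type u} [AddCommGroup M] [Module R M]
    (σ : Mzero R M →+ M)
    (hσ : ∀ (k : K) (x : Mzero R M),
      σ ((algebraMap K R k) • x) = (algebraMap K R k) • σ x) (r : R) (x : Mzero R M) :
    inducedFromSplitting K R M σ hσ (r ⊗ₜ x) = r • σ x := rfl

theorem inducedFromSplitting_map_bijective_of_flat
    (hres : Function.Surjective (algebraMap K (ResidueField R)))
    {M : Type u} [AddCommGroup M] [Module R M] [Module.Flat R M] (σ : Mzero R M →+ M)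
    (hσ : ∀ (k : K) (x : Mzero R M),
      σ ((algebraMap K R k) • x) = (algebraMap K R k) • σ x)
    (hsplit : ∀ x, Submodule.mkQ (maximalIdeal R • (⊤ : Submodule R M)) (σ x) = x) :
    Function.Bijective
      (AdicCompletion.map (maximalIdeal R) (inducedFromSplitting K R M σ hσ)) := by
  refine AdicCompletion.map_bijective_of_flat _
    (mem_maximalIdeal_smul_of_map_mem hres _ fun v hv => ?_)
    fun x => ⟨1 ⊗ₜ x, ?_⟩
  · rw [inducedFromSplitting_tmul, one_smul] at hv
    rw [← hsplit v, Submodule.mkQ_apply, Submodule.Quotient.mk_eq_zero]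
    exact hv
  · rw [LinearMap.comp_apply, inducedFromSplitting_tmul, one_smul, hsplit]

variable (K) in
theorem exists_splitting (M : Type u) [AddCommGroup M] [Module R M] :
    ∃ σ : Mzero R M →+ M,
      (∀ (k : K) (x : Mzero R M), σ ((algebraMap K R k) • x) = (algebraMap K R k) • σ x) ∧
      ∀ x, Submodule.mkQ (maximalIdeal R • (⊤ : Submodule R M)) (σ x) = x := by
  let _ : Module K M := Module.compHom _ (algebraMap K R)
  let q : M →ₗ[K] Mzero R M :=
    { toFun := Submodule.mkQ (maximalIdeal R • (⊤ : Submodule R M))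
      map_add' := map_add _
      map_smul' := fun k x => map_smul (Submodule.mkQ _) (algebraMap K R k) x }
  have hq : Function.Surjective q :=
    Submodule.mkQ_surjective (maximalIdeal R • (⊤ : Submodule R M))
  obtain ⟨σ, hσ⟩ := LinearMap.exists_rightInverse_of_surjective q (LinearMap.range_eq_top.2 hq)
  exact ⟨σ.toAddMonoidHom, fun k x => σ.map_smul k x, fun x => LinearMap.congr_fun hσ x⟩

end MainImplications

/-- Let `K` be a field, `(R, 𝔪)` a parameter `K`-algebra and `M` an
`R`-module; set `M_i := R_i ⊗_R M` where `R_i := R/𝔪^{i+1}`.  The following are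
equivalent:
(i) `M` is flat over `R` and `𝔪`-adically complete;
(ii) there is an `𝔪`-adic system `{N_i}` of `R`-modules, with each `N_i` flat over
`R_i`, and an isomorphism of `R`-modules `M ≅ lim_i N_i`;
(iii) there is a `K`-module `V` and an isomorphism of `R`-modules `M ≅ R ⊗̂ V`
(the `𝔪`-adic completion of `R ⊗_K V`);
(iv) `M` is `𝔪`-adically complete, and for every `K`-linear splitting `σ : M₀ → M` of
the canonical surjection `M → M₀`, the induced `R`-linear homomorphism
`R ⊗̂ M₀ → M` (the `𝔪`-adic completion of `r ⊗ x ↦ r • σ(x)`) is bijective. -/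
theorem stmt_0
    (K : Type u) [Field K]
    (R : Type u) [CommRing R] [Algebra K R] [IsLocalRing R] [IsNoetherianRing R]
    (M : Type u) [AddCommGroup M] [Module R M]
    (hres : Function.Bijective (algebraMap K (IsLocalRing.ResidueField R)))
    [IsAdicComplete (IsLocalRing.maximalIdeal R) R] :
    List.TFAE
      [ -- (i)
        Module.Flat R M ∧ IsAdicComplete (IsLocalRing.maximalIdeal R) M,
        -- (ii)
        ∃ (N : ℕ → Type u) (_ : ∀ i, AddCommGroup (N i)) (_ : ∀ i, Module R (N i))
            (htor : ∀ i, Module.IsTorsionBySet R (N i)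
              (((IsLocalRing.maximalIdeal R) ^ (i + 1) : Ideal R) : Set R))
            (ψ : ∀ i, N (i + 1) →ₗ[R] N i),
          (∀ i, Function.Surjective (ψ i)) ∧
          (∀ i, LinearMap.ker (ψ i) =
            ((IsLocalRing.maximalIdeal R) ^ (i + 1)) • (⊤ : Submodule R (N (i + 1)))) ∧
          (∀ i, @Module.Flat (R ⧸ ((IsLocalRing.maximalIdeal R) ^ (i + 1))) (N i) _ _
            ((htor i).module)) ∧
          Nonempty (M ≃ₗ[R] invLimit N ψ),
        -- (iii)
        ∃ (V : Type u) (_ : AddCommGroup V) (_ : Module K V),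
          Nonempty (M ≃ₗ[R] AdicCompletion (IsLocalRing.maximalIdeal R) (R ⊗[K] V)),
        -- (iv)
        IsAdicComplete (IsLocalRing.maximalIdeal R) M ∧
          ∀ (σ : Mzero R M →+ M)
            (hσ : ∀ (k : K) (x : Mzero R M),
              σ ((algebraMap K R k) • x) = (algebraMap K R k) • σ x),
            (∀ x, Submodule.mkQ
                ((IsLocalRing.maximalIdeal R) • (⊤ : Submodule R M)) (σ x) = x) →
            Function.Bijective
              (AdicCompletion.map (IsLocalRing.maximalIdeal R)
                (inducedFromSplitting K R M σ hσ)) ] := by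
  have hsurj := hres.surjective
  tfae_have 1 → 2
  | ⟨_, _⟩ => exists_adic_system_of_flat _
  tfae_have 2 → 3
  | ⟨N, _, _, htor, ψ, hψ, hker, hflat, ⟨e⟩⟩ => by
    obtain ⟨V, _, _, ⟨e'⟩⟩ :=
      exists_linearEquiv_adicCompletion_of_adic_system hsurj htor hψ hker hflat
    exact ⟨V, _, _, ⟨e.trans e'⟩⟩
  tfae_have 3 → 1
  | ⟨V, _, _, ⟨e⟩⟩ =>
    have := AdicCompletion.flat_of_basis (IsLocalRing.maximalIdeal R)
      (Module.Free.chooseBasis R (R ⊗[K] V))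
    ⟨.of_linearEquiv e, AdicCompletion.isAdicComplete_of_linearEquiv
      (IsNoetherian.noetherian _) e⟩
  tfae_have 1 → 4
  | ⟨_, h⟩ => ⟨h, fun σ hσ hsplit =>
      inducedFromSplitting_map_bijective_of_flat hsurj σ hσ hsplit⟩
  tfae_have 4 → 3
  | ⟨_, h⟩ => by
    obtain ⟨σ, hσ, hsplit⟩ := exists_splitting K (R := R) M
    exact ⟨Mzero R M, inferInstance, inferInstance,
      ⟨(AdicCompletion.ofLinearEquiv (IsLocalRing.maximalIdeal R) M).trans
        ((LinearEquiv.ofBijective _ (h σ hσ hsplit)).restrictScalars R).symm⟩⟩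
  tfae_finish
end

section
/- Let K be a field, R a parameter K-algebra, C a commutative K-algebra, A an associative R-deformation of C, and τ : C → C' a principal localization. Then there exist an associative R-deformation A' of C' and an R-algebra homomorphism g : A → A' lifting τ, i.e., such that the augmentation A' → C' composed with g equals τ composed with the augmentation A → C. -/
universe u

open TensorProduct

section Flatness

variable {R : Type*} [CommRing R]

/-- A linear map satisfying a uniform Artin–Rees estimate with constant `c`: elements whose image
is divisible by `I ^ (n + c)` agree with an element of the kernel up to `I ^ n`. -/
def IsArtinRees (I : Ideal R) {P Q : Type*} [AddCommGroup P] [Module R P]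
    [AddCommGroup Q] [Module R Q] (f : P →ₗ[R] Q) (c : ℕ) : Prop :=
  ∀ n p, f p ∈ (I ^ (n + c) • ⊤ : Submodule R Q) →
    ∃ p₀ ∈ LinearMap.ker f, p - p₀ ∈ (I ^ n • ⊤ : Submodule R P)

theorem IsArtinRees.exact_map {I : Ideal R} {P Q S : Type*} [AddCommGroup P] [Module R P]
    [AddCommGroup Q] [Module R Q] [AddCommGroup S] [Module R S]
    {f : P →ₗ[R] Q} {g : Q →ₗ[R] S} (hfg : Function.Exact f g) {c d : ℕ}
    (hf : IsArtinRees I f c) (hg : IsArtinRees I g d) (x : AdicCompletion I Q)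
    (hx : AdicCompletion.map I g x = 0) : ∃ y, AdicCompletion.map I f y = x := by
  obtain ⟨a, rfl⟩ := AdicCompletion.mk_surjective I Q x
  have h1 : ∀ n, ∃ p, a n - f p ∈ (I ^ n • ⊤ : Submodule R Q) := by
    intro n
    have h : g (a (n + d)) ∈ (I ^ (n + d) • ⊤ : Submodule R S) := by
      simpa using congrArg (fun z ↦ z.val (n + d)) hx
    obtain ⟨q, hq, hq'⟩ := hg n _ h
    obtain ⟨p, rfl⟩ := (hfg q).1 hq
    refine ⟨p, ?_⟩
    have h2 := SModEq.sub_mem.1 (a.2 (Nat.le_add_right n d))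
    simpa using add_mem h2 hq'
  choose p hp using h1
  have le : ∀ {m n : ℕ} {T : Type _} [AddCommGroup T] [Module R T], m ≤ n →
      (I ^ n • ⊤ : Submodule R T) ≤ I ^ m • ⊤ := fun h ↦
    Submodule.smul_mono_left (Ideal.pow_le_pow_right h)
  have happ : ∀ n, a n - f (p (n + c)) ∈ (I ^ n • ⊤ : Submodule R Q) := fun n ↦ by
    have h2 := SModEq.sub_mem.1 (a.2 (Nat.le_add_right n c))
    simpa using add_mem h2 (le (Nat.le_add_right n c) (hp (n + c)))
  have hstep : ∀ n, f (p (n + 1 + c) - p (n + c)) ∈ (I ^ (n + c) • ⊤ : Submodule R Q) := by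
    intro n
    have h1 := hp (n + c)
    have h2 := le (by omega : n + c ≤ n + 1 + c) (hp (n + 1 + c))
    have h3 := SModEq.sub_mem.1 (a.2 (by omega : n + c ≤ n + 1 + c))
    have : f (p (n + 1 + c) - p (n + c)) = (a (n + c) - f (p (n + c))) -
        (a (n + 1 + c) - f (p (n + 1 + c))) - (a (n + c) - a (n + 1 + c)) := by
      rw [map_sub]; abel
    rw [this]
    exact sub_mem (sub_mem h1 h2) h3
  choose k hk hk' using fun n ↦ hf n _ (hstep n)
  let b : ℕ → P := fun n ↦ p (n + c) - ∑ i ∈ Finset.range n, k i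
  have hb : ∀ n, b n ≡ b (n + 1) [SMOD (I ^ n • ⊤ : Submodule R P)] := by
    intro n
    refine SModEq.symm (SModEq.sub_mem.2 ?_)
    have : b (n + 1) - b n = p (n + 1 + c) - p (n + c) - k n := by
      simp only [b, Finset.sum_range_succ]; abel
    rw [this]; exact hk' n
  refine ⟨AdicCompletion.mk I P (AdicCompletion.AdicCauchySequence.mk I P b hb), ?_⟩
  ext n
  have hfb : f (b n) = f (p (n + c)) := by
    simp only [b, map_sub, map_sum]
    rw [Finset.sum_eq_zero (fun i _ ↦ hk i), sub_zero]
  have := happ n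
  rw [← hfb] at this
  simpa using! ((Submodule.Quotient.eq _).2 this).symm

theorem Module.Flat.exists_isArtinRees_lTensor [IsNoetherianRing R] (I : Ideal R)
    (M : Type*) [AddCommGroup M] [Module R M] [Module.Flat R M]
    {P Q : Type*} [AddCommGroup P] [Module R P] [AddCommGroup Q] [Module R Q]
    [Module.Finite R Q] (z : P →ₗ[R] Q) : ∃ c, IsArtinRees I (z.lTensor M) c := by
  obtain ⟨c, hc⟩ := Ideal.exists_pow_inf_eq_pow_smul I (LinearMap.range z)
  refine ⟨c, fun n u hu ↦ ?_⟩
  let J : Submodule R Q := I ^ (n + c) • ⊤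
  have hJ : J.comap z ≤ LinearMap.ker z ⊔ I ^ n • ⊤ := by
    intro v hv
    have h1 : z v ∈ I ^ n • (I ^ c • ⊤ ⊓ LinearMap.range z) := by
      have := hc (n + c) (Nat.le_add_left _ _)
      rw [Nat.add_sub_cancel] at this
      rw [← this]
      exact ⟨hv, v, rfl⟩
    have h2 : z v ∈ (I ^ n • ⊤ : Submodule R P).map z := by
      rw [Submodule.map_smul'', Submodule.map_top]
      exact Submodule.smul_mono le_rfl inf_le_right h1
    obtain ⟨w, hw, hwv⟩ := h2
    rw [← sub_add_cancel v w]
    exact add_mem (Submodule.mem_sup_left (by simp [hwv])) (Submodule.mem_sup_right hw)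
  have hex : Function.Exact (J.comap z).subtype (J.mkQ ∘ₗ z) := by
    intro v
    simp
  have hzero : (J.mkQ ∘ₗ z).lTensor M u = 0 := by
    rw [LinearMap.lTensor_comp, LinearMap.comp_apply]
    generalize z.lTensor M u = t at hu
    induction hu using Submodule.smul_induction_on' with
    | smul r hr x _ =>
      rw [map_smul]
      induction x with
      | zero => simp
      | tmul m q =>
        rw [LinearMap.lTensor_tmul, ← TensorProduct.tmul_smul, ← map_smul]
        have : J.mkQ (r • q) = 0 := by
          rw [Submodule.mkQ_apply, Submodule.Quotient.mk_eq_zero]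
          exact Submodule.smul_mem_smul hr trivial
        rw [this, TensorProduct.tmul_zero]
      | add x y hx hy => rw [map_add, smul_add, hx trivial, hy trivial, add_zero]
    | add x _ y _ hx hy => rw [map_add, hx, hy, add_zero]
  obtain ⟨u', rfl⟩ := (Module.Flat.lTensor_exact M hex u).1 hzero
  clear hzero hu
  induction u' with
  | zero => exact ⟨0, by simp, by simp⟩
  | add x y hx hy =>
    obtain ⟨x₀, hx₀, hx⟩ := hx
    obtain ⟨y₀, hy₀, hy⟩ := hy
    refine ⟨x₀ + y₀, add_mem hx₀ hy₀, ?_⟩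
    rw [map_add, add_sub_add_comm]
    exact add_mem hx hy
  | tmul m v =>
    obtain ⟨k, hk, w, hw, hkw⟩ := Submodule.mem_sup.1 (hJ v.2)
    refine ⟨m ⊗ₜ k, ?_, ?_⟩
    · rw [LinearMap.mem_ker, LinearMap.lTensor_tmul, LinearMap.mem_ker.1 hk,
        TensorProduct.tmul_zero]
    · rw [LinearMap.lTensor_tmul, Submodule.subtype_apply, ← hkw, TensorProduct.tmul_add,
        add_sub_cancel_left]
      have : TensorProduct.mk R M P m w ∈
          (I ^ n • ⊤ : Submodule R P).map (TensorProduct.mk R M P m) := ⟨w, hw, rfl⟩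
      rw [Submodule.map_smul''] at this
      exact Submodule.smul_mono le_rfl le_top this

theorem AdicCompletion.map_linearCombination_apply (I : Ideal R) {M N : Type*} [AddCommGroup M]
    [Module R M] [AddCommGroup N] [Module R N] {ι : Type*} (s : Finset ι) (r : ι → R)
    (h : ι → M →ₗ[R] N) (x : AdicCompletion I M) :
    AdicCompletion.map I (∑ i ∈ s, r i • h i) x = ∑ i ∈ s, r i • AdicCompletion.map I (h i) x := by
  induction x using AdicCompletion.induction_on with
  | h a =>
    ext n
    simp [AdicCompletion.val_sum_apply, LinearMap.sum_apply]
    exact Finset.sum_congr rfl fun _ _ ↦ rfl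

theorem AdicCompletion.map_smul_apply (I : Ideal R) {M N : Type*} [AddCommGroup M]
    [Module R M] [AddCommGroup N] [Module R N] (r : R) (h : M →ₗ[R] N) (x : AdicCompletion I M) :
    AdicCompletion.map I (r • h) x = r • AdicCompletion.map I h x := by
  simpa using AdicCompletion.map_linearCombination_apply I {()} (fun _ ↦ r) (fun _ ↦ h) x

/-- The adic completion of a flat module over a noetherian ring is flat. -/
theorem AdicCompletion.flat_of_flat [IsNoetherianRing R] (I : Ideal R)
    (M : Type*) [AddCommGroup M] [Module R M] [Module.Flat R M] :
    Module.Flat R (AdicCompletion I M) := by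
  refine Module.Flat.of_forall_isTrivialRelation fun {l f x} hfx ↦ ?_
  let g : (Fin l → R) →ₗ[R] R := Fintype.linearCombination R f
  obtain ⟨q, w, hw⟩ := (Submodule.fg_iff_exists_fin_linearMap _ _).1 <|
    IsNoetherian.noetherian (LinearMap.ker g)
  have hwg : Function.Exact w g := LinearMap.exact_iff.2 hw.symm
  obtain ⟨c, hc⟩ := Module.Flat.exists_isArtinRees_lTensor I M w
  obtain ⟨d, hd⟩ := Module.Flat.exists_isArtinRees_lTensor I M g
  let inc (j : Fin l) : M →ₗ[R] M ⊗[R] (Fin l → R) :=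
    (TensorProduct.mk R M (Fin l → R)).flip (Pi.single j 1)
  let comp {n : ℕ} (j : Fin n) : M ⊗[R] (Fin n → R) →ₗ[R] M :=
    (TensorProduct.rid R M).toLinearMap ∘ₗ (LinearMap.proj j).lTensor M
  have hsum : AdicCompletion.map I (g.lTensor M) (∑ j, AdicCompletion.map I (inc j) (x j)) = 0 := by
    have h1 (j : Fin l) : g.lTensor M ∘ₗ inc j = f j • (TensorProduct.mk R M R).flip 1 := by
      ext m
      simp [inc, g, Fintype.linearCombination_apply_single, ← TensorProduct.tmul_smul]
    let t := (AdicCompletion.map I ((TensorProduct.mk R M R).flip 1)).restrictScalars R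
    have h2 : t (∑ j, f j • x j) = 0 := by rw [hfx, t.map_zero]
    rw [map_sum] at h2 ⊢
    rw [← h2]
    refine Finset.sum_congr rfl fun j _ ↦ ?_
    rw [AdicCompletion.map_comp_apply, h1, AdicCompletion.map_smul_apply, map_smul]
    rfl
  obtain ⟨y, hy⟩ := hc.exact_map (Module.Flat.lTensor_exact M hwg) hd _ hsum
  refine ⟨q, fun j b ↦ w (Pi.single b 1) j, fun b ↦ AdicCompletion.map I (comp b) y, ?_, ?_⟩
  · intro j
    have h1 := congrArg (AdicCompletion.map I (comp j)) hy
    have h2 : comp j ∘ₗ w.lTensor M = ∑ b, w (Pi.single b 1) j • comp b := by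
      ext m b
      simp [comp, LinearMap.sum_apply, Pi.single_apply]
    have h3 (k : Fin l) : comp j ∘ₗ inc k = if j = k then LinearMap.id else 0 := by
      ext m
      by_cases h : j = k <;> simp [comp, inc, h]
    rw [AdicCompletion.map_comp_apply, h2, AdicCompletion.map_linearCombination_apply,
      map_sum] at h1
    simp_rw [AdicCompletion.map_comp_apply, h3] at h1
    rw [h1, Finset.sum_eq_single j (fun k _ hk ↦ by simp [hk.symm]) (by simp)]
    simp
  · intro b
    simpa [g, Fintype.linearCombination_apply, mul_comm] using hwg.apply_apply_eq_zero (Pi.single b 1)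

end Flatness
section Completeness

variable {R : Type*} [CommRing R] {I : Ideal R} {M N : Type*} [AddCommGroup M] [Module R M]
  [AddCommGroup N] [Module R N]

theorem LinearEquiv.map_smul_top_mem_iff (e : M ≃ₗ[R] N) (J : Ideal R) (x : M) :
    e x ∈ (J • ⊤ : Submodule R N) ↔ x ∈ (J • ⊤ : Submodule R M) := by
  have : (J • ⊤ : Submodule R N) = (J • ⊤ : Submodule R M).map e.toLinearMap := by
    rw [Submodule.map_smul'', Submodule.map_top, LinearEquiv.range]
  rw [this]
  exact e.injective.mem_set_image

theorem LinearMap.map_smul_top_mem (f : M →ₗ[R] N) (J : Ideal R) {x : M}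
    (hx : x ∈ (J • ⊤ : Submodule R M)) : f x ∈ (J • ⊤ : Submodule R N) := by
  have : f x ∈ (J • ⊤ : Submodule R M).map f := ⟨x, hx, rfl⟩
  rw [Submodule.map_smul''] at this
  exact Submodule.smul_mono le_rfl le_top this

theorem IsAdicComplete.of_linearEquiv [IsAdicComplete I M] (e : M ≃ₗ[R] N) :
    IsAdicComplete I N := by
  rw [← AdicCompletion.of_bijective_iff]
  have h : (AdicCompletion.of I N : N → _) =
      AdicCompletion.congr I e ∘ AdicCompletion.of I M ∘ e.symm := by
    ext1 x
    change _ = AdicCompletion.map I e.toLinearMap (AdicCompletion.of I M (e.symm x))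
    simp [AdicCompletion.map_of]
  rw [h]
  exact (AdicCompletion.congr I e).bijective.comp
    ((AdicCompletion.of_bijective I M).comp e.symm.bijective)

theorem AdicCompletion.smul_top_eq_ker_eval_one (hI : I.FG) :
    (I • ⊤ : Submodule R (AdicCompletion I M)) = LinearMap.ker (AdicCompletion.eval I M 1) :=
  .trans (by rw [pow_one]) (AdicCompletion.pow_smul_top_eq_ker_eval hI)

theorem AdicCompletion.linearMap_eq_of_comp_of_eq [IsHausdorff I N] (hI : I.FG)
    {f g : AdicCompletion I M →ₗ[R] N}
    (h : ∀ x, f (AdicCompletion.of I M x) = g (AdicCompletion.of I M x)) : f = g := by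
  refine LinearMap.ext fun x ↦ ?_
  rw [← sub_eq_zero, ← LinearMap.sub_apply]
  refine IsHausdorff.haus (I := I) inferInstance _ fun n ↦ ?_
  rw [SModEq.zero]
  obtain ⟨y, hy⟩ := Submodule.Quotient.mk_surjective _ (AdicCompletion.eval I M n x)
  have h1 : x - AdicCompletion.of I M y ∈ (I ^ n • ⊤ : Submodule R (AdicCompletion I M)) := by
    rw [AdicCompletion.pow_smul_top_eq_ker_eval hI, LinearMap.mem_ker, map_sub, ← hy]
    simp
  have h2 := LinearMap.map_smul_top_mem (f - g) _ h1
  rwa [map_sub, LinearMap.sub_apply f g (AdicCompletion.of I M y), h, sub_self, sub_zero] at h2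

theorem IsAdicComplete.bijective_of_sub_mem [IsAdicComplete I N] (f : N →ₗ[R] N)
    (hf : ∀ x, f x - x ∈ (I • ⊤ : Submodule R N)) : Function.Bijective f := by
  constructor
  · rw [injective_iff_map_eq_zero]
    intro x hx
    refine IsHausdorff.haus (I := I) inferInstance _ fun n ↦ ?_
    rw [SModEq.zero]
    induction n with
    | zero => simp
    | succ n ih =>
      have h1 : (f - LinearMap.id : N →ₗ[R] N) x ∈
          (I ^ n • ⊤ : Submodule R N).map (f - LinearMap.id : N →ₗ[R] N) := ⟨x, ih, rfl⟩
      rw [Submodule.map_smul''] at h1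
      have h2 : (⊤ : Submodule R N).map (f - LinearMap.id : N →ₗ[R] N) ≤ I • ⊤ := by
        rintro _ ⟨y, -, rfl⟩
        exact hf y
      have h3 := Submodule.smul_mono le_rfl h2 h1
      rw [← Submodule.mul_smul, ← pow_succ] at h3
      simpa [hx] using h3
  · refine surjective_of_mkQ_comp_surjective (I := I) fun y ↦ ?_
    obtain ⟨x, rfl⟩ := Submodule.mkQ_surjective _ y
    exact ⟨x, (Submodule.Quotient.eq _).2 (hf x)⟩

theorem AdicCompletion.map_bijective_of_sub_mem (hI : I.FG) (f : M →ₗ[R] M) (σ : M ≃ₗ[R] M)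
    (h : ∀ x, f x - σ x ∈ (I • ⊤ : Submodule R M)) :
    Function.Bijective (AdicCompletion.map I f) := by
  have := AdicCompletion.isAdicComplete (M := M) hI
  have h1 := IsAdicComplete.bijective_of_sub_mem (I := I)
    ((AdicCompletion.map I (f ∘ₗ σ.symm.toLinearMap)).restrictScalars R) (fun x ↦ by
      rw [AdicCompletion.smul_top_eq_ker_eval_one hI, LinearMap.mem_ker]
      induction x using AdicCompletion.induction_on with
      | h a =>
        have h2 := h (σ.symm (a 1))
        rw [σ.apply_symm_apply] at h2
        rw [map_sub, sub_eq_zero]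
        refine (Submodule.Quotient.eq _).2 ?_
        rw [pow_one]
        exact h2)
  have h2 : (AdicCompletion.map I f : AdicCompletion I M → _) =
      AdicCompletion.map I (f ∘ₗ σ.symm.toLinearMap) ∘ AdicCompletion.congr I σ := by
    ext1 x
    change _ = AdicCompletion.map I _ (AdicCompletion.map I σ.toLinearMap x)
    rw [AdicCompletion.map_comp_apply, LinearMap.comp_assoc]
    simp
  rw [h2]
  exact h1.comp (AdicCompletion.congr I σ).bijective

end Completeness

section DirectLimit

theorem Module.DirectLimit.flat {R ι : Type*} [CommRing R] [Preorder ι] [DecidableEq ι]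
    [IsDirectedOrder ι] [Nonempty ι] (G : ι → Type*) [∀ i, AddCommGroup (G i)]
    [∀ i, Module R (G i)] (f : ∀ i j, i ≤ j → G i →ₗ[R] G j)
    [DirectedSystem G (f · · ·)] [∀ i, Module.Flat R (G i)] :
    Module.Flat R (Module.DirectLimit G f) := by
  refine Module.Flat.of_forall_isTrivialRelation fun {l r x} hrx ↦ ?_
  choose i a ha using fun b ↦ Module.DirectLimit.exists_of (x b)
  obtain ⟨k, hk⟩ := Finset.exists_le (Finset.univ.image i)
  have hk' (b : Fin l) : i b ≤ k := hk _ (Finset.mem_image_of_mem _ (Finset.mem_univ b))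
  have h0 : Module.DirectLimit.of R ι G f k (∑ b, r b • f (i b) k (hk' b) (a b)) = 0 := by
    simpa [map_sum, Module.DirectLimit.of_f, ha] using hrx
  obtain ⟨j, hkj, hj⟩ := Module.DirectLimit.of.zero_exact h0
  simp only [map_sum, map_smul] at hj
  obtain ⟨q, w, y, hy, hw⟩ := Module.Flat.isTrivialRelation_of_sum_smul_eq_zero hj
  refine ⟨q, w, fun b ↦ Module.DirectLimit.of R ι G f j (y b), fun b ↦ ?_, hw⟩
  have := congrArg (Module.DirectLimit.of R ι G f j) (hy b)
  simpa [map_sum, Module.DirectLimit.of_f, ha] using this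

variable (R : Type*) [CommRing R] {A : Type*} [Ring A] [Algebra R A] (t : A)

/-- The transition maps of the system `A → A → A → ⋯` given by left multiplication by `t`. -/
def leftMulSystem (i j : ℕ) (_ : i ≤ j) : A →ₗ[R] A := LinearMap.mulLeft R (t ^ (j - i))

instance : DirectedSystem (fun _ : ℕ ↦ A) (leftMulSystem R t · · ·) where
  map_self i x := by simp [leftMulSystem]
  map_map i j k hij hjk x := by
    simp only [leftMulSystem, LinearMap.mulLeft_apply, ← mul_assoc, ← pow_add]
    congr 2
    omega

/-- The right `A`-module of left fractions `t⁻ᵏ a`, as the colimit of the system `A → A → A → ⋯`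
given by left multiplication by `t`. -/
abbrev LeftFractions : Type _ := Module.DirectLimit (fun _ : ℕ ↦ A) (leftMulSystem R t)

namespace LeftFractions

/-- The fraction `t⁻ᵏ a`. -/
noncomputable def frac (k : ℕ) : A →ₗ[R] LeftFractions R t :=
  Module.DirectLimit.of R ℕ (fun _ ↦ A) (leftMulSystem R t) k

theorem exists_frac (x : LeftFractions R t) : ∃ k a, frac R t k a = x :=
  Module.DirectLimit.exists_of x

theorem frac_add_pow_mul (k j : ℕ) (a : A) : frac R t (k + j) (t ^ j * a) = frac R t k a := by
  have := Module.DirectLimit.of_f (R := R) (G := fun _ : ℕ ↦ A) (f := leftMulSystem R t)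
    (hij := Nat.le_add_right k j) (x := a)
  simp only [leftMulSystem, LinearMap.mulLeft_apply, Nat.add_sub_cancel_left] at this
  exact this

theorem frac_succ_mul (k : ℕ) (a : A) : frac R t (k + 1) (t * a) = frac R t k a := by
  simpa using frac_add_pow_mul R t k 1 a

section lift

variable {R t} {N : Type*} [AddCommGroup N] [Module R N]

theorem exists_lift (g : ℕ → A →ₗ[R] N) (hg : ∀ k a, g (k + 1) (t * a) = g k a) :
    ∃ φ : LeftFractions R t →ₗ[R] N, ∀ k a, φ (frac R t k a) = g k a := by
  have h (k j : ℕ) : ∀ a, g (k + j) (t ^ j * a) = g k a := by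
    induction j with
    | zero => simp
    | succ j ih =>
      intro a
      rw [pow_succ', mul_assoc, ← add_assoc, hg, ih]
  refine ⟨Module.DirectLimit.lift R ℕ _ (leftMulSystem R t) g fun i j hij a ↦ ?_,
    fun k a ↦ Module.DirectLimit.lift_of _ _ _⟩
  obtain ⟨d, rfl⟩ := Nat.exists_eq_add_of_le hij
  simpa [leftMulSystem] using h i d a

end lift

/-- Right multiplication by `b` on left fractions. -/
noncomputable def mulRight (b : A) : LeftFractions R t →ₗ[R] LeftFractions R t :=
  Module.DirectLimit.map (fun _ ↦ LinearMap.mulRight R b) fun _ _ _ ↦ by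
    ext; simp [leftMulSystem, mul_assoc]

@[simp]
theorem mulRight_frac (b : A) (k : ℕ) (a : A) :
    mulRight R t b (frac R t k a) = frac R t k (a * b) :=
  Module.DirectLimit.map_apply_of _ _ _

/-- Left multiplication by `t` on left fractions, an automorphism. -/
theorem exists_mulLeftEquiv : ∃ σ : LeftFractions R t ≃ₗ[R] LeftFractions R t,
    ∀ k a, σ (frac R t k a) = frac R t k (t * a) := by
  obtain ⟨f, hf⟩ := exists_lift (t := t) (fun k ↦ frac R t k ∘ₗ LinearMap.mulLeft R t)
    fun k a ↦ by simp [frac_succ_mul]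
  obtain ⟨g, hg⟩ := exists_lift (t := t) (fun k ↦ frac R t (k + 1))
    fun k a ↦ frac_succ_mul R t (k + 1) a
  refine ⟨.ofLinearMap f g ?_ ?_, hf⟩ <;>
  · refine LinearMap.ext fun x ↦ ?_
    obtain ⟨k, a, rfl⟩ := exists_frac R t x
    simp [hf, hg, frac_succ_mul]

end LeftFractions

end DirectLimit
section CompletedFractions

variable {R : Type*} [CommRing R] (I : Ideal R) {A : Type*} [Ring A] [Algebra R A] (t : A)

/-- The `I`-adic completion of the right `A`-module of left fractions `t⁻ᵏ a`. -/
abbrev CompletedFractions : Type _ := AdicCompletion I (LeftFractions R t)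

namespace CompletedFractions

/-- The fraction `t⁻ᵏ a` in the completion. -/
noncomputable def frac (k : ℕ) : A →ₗ[R] CompletedFractions I t :=
  AdicCompletion.of I _ ∘ₗ LeftFractions.frac R t k

/-- Right multiplication by `b` on the completion. -/
noncomputable def mulRight (b : A) : Module.End R (CompletedFractions I t) :=
  (AdicCompletion.map I (LeftFractions.mulRight R t b)).restrictScalars R

@[simp]
theorem mulRight_frac (b : A) (k : ℕ) (a : A) :
    mulRight I t b (frac I t k a) = frac I t k (a * b) :=
  (AdicCompletion.map_of I (LeftFractions.mulRight R t b) (LeftFractions.frac R t k a)).trans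
    (congrArg (AdicCompletion.of I _) (LeftFractions.mulRight_frac R t b k a))

theorem frac_succ_mul (k : ℕ) (a : A) : frac I t (k + 1) (t * a) = frac I t k a := by
  simp [frac, LeftFractions.frac_succ_mul]

theorem frac_pow (k : ℕ) : frac I t k (t ^ k) = frac I t 0 1 := by
  induction k with
  | zero => simp
  | succ k ih => rw [pow_succ', frac_succ_mul, ih]

variable {I t} in
theorem hom_ext (hI : I.FG) {N : Type*} [AddCommGroup N] [Module R N] [IsHausdorff I N]
    {f g : CompletedFractions I t →ₗ[R] N}
    (h : ∀ k a, f (frac I t k a) = g (frac I t k a)) : f = g := by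
  refine AdicCompletion.linearMap_eq_of_comp_of_eq hI fun x ↦ ?_
  obtain ⟨k, a, rfl⟩ := LeftFractions.exists_frac R t x
  exact h k a

variable {I}

theorem mulRight_add (hI : I.FG) (a b : A) :
    mulRight I t (a + b) = mulRight I t a + mulRight I t b :=
  hom_ext hI fun k c ↦ by simp [mul_add]

theorem mulRight_smul (hI : I.FG) (r : R) (a : A) :
    mulRight I t (r • a) = r • mulRight I t a :=
  hom_ext hI fun k c ↦ by simp

theorem mulRight_mul (hI : I.FG) (a b : A) :
    mulRight I t (a * b) = mulRight I t b * mulRight I t a :=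
  hom_ext hI fun k c ↦ by simp [mul_assoc]

theorem mulRight_one (hI : I.FG) : mulRight I t 1 = 1 :=
  hom_ext hI fun k c ↦ by simp

variable {t}

theorem mulRight_bijective (hI : I.FG)
    (ht : ∀ a, a * t - t * a ∈ (I • ⊤ : Submodule R A)) :
    Function.Bijective (mulRight I t t) := by
  obtain ⟨σ, hσ⟩ := LeftFractions.exists_mulLeftEquiv R t
  refine AdicCompletion.map_bijective_of_sub_mem hI _ σ fun x ↦ ?_
  obtain ⟨k, a, rfl⟩ := LeftFractions.exists_frac R t x
  rw [hσ, LeftFractions.mulRight_frac, ← map_sub]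
  exact LinearMap.map_smul_top_mem _ _ (ht a)

theorem mulRight_pow_bijective (hI : I.FG)
    (ht : ∀ a, a * t - t * a ∈ (I • ⊤ : Submodule R A)) (k : ℕ) :
    Function.Bijective (mulRight I t (t ^ k)) := by
  induction k with
  | zero =>
    rw [pow_zero, mulRight_one t hI]
    exact Function.bijective_id
  | succ k ih =>
    rw [pow_succ, mulRight_mul t hI]
    exact (mulRight_bijective hI ht).comp ih

variable (I t) in
/-- The `R`-algebra of endomorphisms of the completion commuting with right multiplication. -/
abbrev RightLinearEnd : Type _ :=
  Subalgebra.centralizer R (Set.range (mulRight I t))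

variable (I t) in
/-- Evaluation of an endomorphism at the fraction `1`. -/
noncomputable def evalOne : RightLinearEnd I t →ₗ[R] CompletedFractions I t :=
  LinearMap.applyₗ (frac I t 0 1) ∘ₗ (Subalgebra.centralizer R _).val.toLinearMap

theorem mulRight_comm (φ : RightLinearEnd I t) (b : A) (x : CompletedFractions I t) :
    φ.1 (mulRight I t b x) = mulRight I t b (φ.1 x) :=
  (LinearMap.congr_fun ((Subalgebra.mem_centralizer_iff R).1 φ.2 _ ⟨b, rfl⟩) x).symm

theorem evalOne_injective (hI : I.FG)
    (ht : ∀ a, a * t - t * a ∈ (I • ⊤ : Submodule R A)) : Function.Injective (evalOne I t) := by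
  rw [injective_iff_map_eq_zero]
  intro φ hφ
  have hφ' : φ.1 (frac I t 0 1) = 0 := hφ
  refine Subtype.ext (hom_ext hI fun k a ↦ ?_)
  have h1 : φ.1 (frac I t k 1) = 0 := by
    refine (mulRight_pow_bijective hI ht k).1 ?_
    rw [← mulRight_comm, mulRight_frac, one_mul, frac_pow, hφ', map_zero]
  have h2 := mulRight_comm φ a (frac I t k 1)
  rwa [h1, map_zero, mulRight_frac, one_mul] at h2

theorem evalOne_surjective (hI : I.FG)
    (ht : ∀ a, a * t - t * a ∈ (I • ⊤ : Submodule R A)) : Function.Surjective (evalOne I t) := by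
  intro m
  have := AdicCompletion.isAdicComplete (M := LeftFractions R t) hI
  choose q hq using fun k ↦ (mulRight_pow_bijective hI ht k).2 m
  have hq' (k : ℕ) : mulRight I t t (q (k + 1)) = q k := by
    refine (mulRight_pow_bijective hI ht k).1 ?_
    rw [← Module.End.mul_apply, ← mulRight_mul t hI, ← pow_succ', hq, hq]
  obtain ⟨φ₀, hφ₀⟩ := LeftFractions.exists_lift (R := R) (t := t)
    (N := CompletedFractions I t) (fun k ↦
      { toFun a := mulRight I t a (q k)
        map_add' a b := by rw [mulRight_add t hI, LinearMap.add_apply]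
        map_smul' r a := by rw [mulRight_smul t hI, LinearMap.smul_apply, RingHom.id_apply] })
    fun k a ↦ by
      simp only [LinearMap.coe_mk, AddHom.coe_mk]
      rw [mulRight_mul t hI, Module.End.mul_apply, hq']
  let φ : Module.End R (CompletedFractions I t) :=
    (AdicCompletion.ofLinearEquiv I (CompletedFractions I t)).symm.toLinearMap ∘ₗ
      (AdicCompletion.map I φ₀).restrictScalars R
  have hφ (k : ℕ) (a : A) : φ (frac I t k a) = mulRight I t a (q k) := by
    simp only [φ, frac, LinearMap.comp_apply, LinearMap.restrictScalars_apply,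
      AdicCompletion.map_of, hφ₀, LinearEquiv.coe_coe, AdicCompletion.ofLinearEquiv_symm_of]
    rfl
  refine ⟨⟨φ, (Subalgebra.mem_centralizer_iff R).2 ?_⟩, ?_⟩
  · rintro _ ⟨b, rfl⟩
    refine hom_ext hI fun k a ↦ ?_
    rw [Module.End.mul_apply, Module.End.mul_apply, mulRight_frac, hφ, hφ, mulRight_mul t hI,
      Module.End.mul_apply]
  · change φ (frac I t 0 1) = m
    rw [hφ, ← hq 0, pow_zero]

/-- Evaluation at `1` as a linear equivalence. -/
noncomputable def evalOneEquiv (hI : I.FG)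
    (ht : ∀ a, a * t - t * a ∈ (I • ⊤ : Submodule R A)) :
    RightLinearEnd I t ≃ₗ[R] CompletedFractions I t :=
  LinearEquiv.ofBijective (evalOne I t) ⟨evalOne_injective hI ht, evalOne_surjective hI ht⟩

/-- An element `a` of `A` acts on the completion by extending `1 ↦ a`. -/
theorem exists_algHom (hI : I.FG) (ht : ∀ a, a * t - t * a ∈ (I • ⊤ : Submodule R A)) :
    ∃ g : A →ₐ[R] RightLinearEnd I t, ∀ a, evalOne I t (g a) = frac I t 0 a := by
  let G : A →ₗ[R] RightLinearEnd I t := (evalOneEquiv hI ht).symm.toLinearMap ∘ₗ frac I t 0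
  have hG (a : A) : (G a).1 (frac I t 0 1) = frac I t 0 a :=
    (evalOneEquiv hI ht).apply_symm_apply (frac I t 0 a)
  have hext {φ ψ : RightLinearEnd I t} (h : φ.1 (frac I t 0 1) = ψ.1 (frac I t 0 1)) : φ = ψ :=
    evalOne_injective hI ht h
  refine ⟨AlgHom.ofLinearMap G (hext ?_) fun a b ↦ hext ?_, hG⟩
  · rw [hG]; rfl
  · change _ = (G a).1 ((G b).1 (frac I t 0 1))
    have h1 : frac I t 0 b = mulRight I t b (frac I t 0 1) := by simp
    rw [hG, hG, h1, mulRight_comm, hG, mulRight_frac]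

end CompletedFractions

end CompletedFractions

section Augmentation

variable {R : Type*} [CommRing R] {I : Ideal R} {A C C' : Type*} [Ring A] [Algebra R A]
  [CommRing C] [Algebra R C] [CommRing C'] [Algebra R C'] [Algebra C C'] [IsScalarTower R C C']
  {t : A} {ψ : A →ₐ[R] C}

theorem LeftFractions.exists_augmentation (hψ : Function.Surjective ψ)
    (hker : ∀ x, ψ x = 0 ↔ x ∈ (I • ⊤ : Submodule R A)) [IsLocalization.Away (ψ t) C'] :
    ∃ π : LeftFractions R t →ₗ[R] C', Function.Surjective π ∧
      (∀ x, π x = 0 ↔ x ∈ (I • ⊤ : Submodule R (LeftFractions R t))) ∧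
      ∀ k a, algebraMap C C' (ψ t) ^ k * π (frac R t k a) = algebraMap C C' (ψ a) := by
  set s : C' := algebraMap C C' (ψ t) with hs
  set u : C' := IsLocalization.Away.invSelf (ψ t) with hu
  have hsu : s * u = 1 := IsLocalization.Away.mul_invSelf (ψ t)
  have hsu' (k : ℕ) : s ^ k * u ^ k = 1 := by rw [← mul_pow, hsu, one_pow]
  obtain ⟨π, hπ⟩ := exists_lift (R := R) (t := t) (fun k ↦ LinearMap.mulLeft R (u ^ k) ∘ₗ
      ((IsScalarTower.toAlgHom R C C').comp ψ).toLinearMap) fun k a ↦ by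
    simp only [LinearMap.comp_apply, AlgHom.toLinearMap_apply, AlgHom.comp_apply,
      IsScalarTower.coe_toAlgHom', LinearMap.mulLeft_apply, map_mul, ← hs]
    linear_combination (u ^ k * algebraMap C C' (ψ a)) * hsu
  have hπ' (k : ℕ) (a : A) : π (frac R t k a) = u ^ k * algebraMap C C' (ψ a) := hπ k a
  have hfrac (k : ℕ) (a : A) : s ^ k * π (frac R t k a) = algebraMap C C' (ψ a) := by
    rw [hπ', ← mul_assoc, hsu', one_mul]
  refine ⟨π, fun y ↦ ?_, fun x ↦ ⟨fun hx ↦ ?_, fun hx ↦ ?_⟩, hfrac⟩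
  · obtain ⟨k, c, hc⟩ := IsLocalization.Away.surj (ψ t) y
    obtain ⟨a, rfl⟩ := hψ c
    refine ⟨frac R t k a, ?_⟩
    rw [hπ', ← hc, ← hs]
    linear_combination y * hsu' k
  · obtain ⟨k, a, rfl⟩ := exists_frac R t x
    have h1 : algebraMap C C' (ψ a) = 0 := by rw [← hfrac k a, hx, mul_zero]
    obtain ⟨⟨_, j, rfl⟩, hj⟩ :=
      (IsLocalization.map_eq_zero_iff (Submonoid.powers (ψ t)) C' (ψ a)).1 h1
    rw [← frac_add_pow_mul R t k j a]
    refine LinearMap.map_smul_top_mem _ _ ((hker _).1 ?_)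
    rw [map_mul, map_pow]
    exact hj
  · have h1 := LinearMap.map_smul_top_mem π I hx
    have h2 : (I • ⊤ : Submodule R C') = ⊥ := by
      rw [eq_bot_iff, Submodule.smul_le]
      intro r hr y _
      have h3 : algebraMap R C r = 0 := by
        rw [← ψ.commutes r, hker, Algebra.algebraMap_eq_smul_one]
        exact Submodule.smul_mem_smul hr trivial
      rw [Submodule.mem_bot, Algebra.smul_def, IsScalarTower.algebraMap_apply R C C', h3, map_zero,
        zero_mul]
    rwa [h2] at h1

namespace CompletedFractions

theorem exists_augmentation (hI : I.FG) (hψ : Function.Surjective ψ)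
    (hker : ∀ x, ψ x = 0 ↔ x ∈ (I • ⊤ : Submodule R A)) [IsLocalization.Away (ψ t) C'] :
    ∃ π : CompletedFractions I t →ₗ[R] C', Function.Surjective π ∧
      (∀ x, π x = 0 ↔ x ∈ (I • ⊤ : Submodule R (CompletedFractions I t))) ∧
      ∀ k a, algebraMap C C' (ψ t) ^ k * π (frac I t k a) = algebraMap C C' (ψ a) := by
  obtain ⟨π₀, hsurj, hπ₀, hfrac⟩ := LeftFractions.exists_augmentation (C' := C') (t := t) hψ hker
  have hker₀ : LinearMap.ker π₀ = I ^ 1 • ⊤ := by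
    rw [pow_one]
    exact Submodule.ext hπ₀
  refine ⟨(I ^ 1 • ⊤ : Submodule R (LeftFractions R t)).liftQ π₀ hker₀.ge ∘ₗ
    AdicCompletion.eval I _ 1, fun y ↦ ?_, fun x ↦ ?_, hfrac⟩
  · obtain ⟨x, rfl⟩ := hsurj y
    exact ⟨AdicCompletion.of I _ x, rfl⟩
  · rw [AdicCompletion.smul_top_eq_ker_eval_one hI, LinearMap.mem_ker, LinearMap.comp_apply]
    refine LinearMap.map_eq_zero_iff _ (LinearMap.ker_eq_bot.1 ?_)
    exact Submodule.ker_liftQ_eq_bot' _ _ hker₀.symm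

theorem exists_algHom_augmentation (hI : I.FG) (hψ : Function.Surjective ψ)
    (hker : ∀ x, ψ x = 0 ↔ x ∈ (I • ⊤ : Submodule R A)) [IsLocalization.Away (ψ t) C']
    (ht : ∀ a, a * t - t * a ∈ (I • ⊤ : Submodule R A)) :
    ∃ ψ' : RightLinearEnd I t →ₐ[R] C', Function.Surjective ψ' ∧
      (∀ x, ψ' x = 0 ↔ x ∈ (I • ⊤ : Submodule R (RightLinearEnd I t))) ∧
      ∀ (φ : RightLinearEnd I t) a, evalOne I t φ = frac I t 0 a →
        ψ' φ = algebraMap C C' (ψ a) := by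
  obtain ⟨π, hsurj, hπ, hfrac⟩ := exists_augmentation (C' := C') (t := t) hI hψ hker
  have hunit (k : ℕ) : IsUnit (algebraMap C C' (ψ t) ^ k) :=
    (IsLocalization.Away.algebraMap_isUnit (ψ t)).pow k
  have hfrac₀ (a : A) : π (frac I t 0 a) = algebraMap C C' (ψ a) := by simpa using hfrac 0 a
  have : IsHausdorff I C' := by
    refine ⟨fun y hy ↦ ?_⟩
    have h1 := hy 1
    rw [SModEq.zero, pow_one] at h1
    obtain ⟨x, rfl⟩ := hsurj y
    have h2 : (I • ⊤ : Submodule R C') = (I • ⊤ : Submodule R (CompletedFractions I t)).map π := by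
      rw [Submodule.map_smul'', Submodule.map_top, LinearMap.range_eq_top.2 hsurj]
    rw [h2] at h1
    obtain ⟨z, hz, hzx⟩ := h1
    rw [← hzx, (hπ z).2 hz]
  have hmul (b : A) (x : CompletedFractions I t) :
      π (mulRight I t b x) = algebraMap C C' (ψ b) * π x := by
    refine LinearMap.congr_fun (f := π ∘ₗ mulRight I t b)
      (g := LinearMap.mulLeft R (algebraMap C C' (ψ b)) ∘ₗ π) (hom_ext hI fun k a ↦ ?_) x
    refine (hunit k).mul_left_cancel ?_
    rw [LinearMap.comp_apply, mulRight_frac, hfrac, LinearMap.comp_apply, LinearMap.mulLeft_apply,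
      mul_left_comm, hfrac, map_mul, map_mul, mul_comm]
  have hcomp (φ : RightLinearEnd I t) (x : CompletedFractions I t) :
      π (φ.1 x) = π (φ.1 (frac I t 0 1)) * π x := by
    obtain ⟨k, c, hc⟩ := IsLocalization.Away.surj (ψ t) (π x)
    obtain ⟨a, rfl⟩ := hψ c
    have h1 : mulRight I t (t ^ k) x - mulRight I t a (frac I t 0 1) ∈
        (I • ⊤ : Submodule R (CompletedFractions I t)) := by
      rw [← hπ, map_sub, hmul, hmul, hfrac₀, map_one, map_one, mul_one, ← hc, map_pow, map_pow,
        mul_comm, sub_self]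
    have h2 := (hπ _).2 (LinearMap.map_smul_top_mem φ.1 I h1)
    rw [map_sub, map_sub, mulRight_comm, mulRight_comm, hmul, hmul, sub_eq_zero, map_pow, map_pow,
      ← hc] at h2
    refine (hunit k).mul_left_cancel ?_
    rw [h2]
    ring
  refine ⟨AlgHom.ofLinearMap (π ∘ₗ evalOne I t) ?_ fun φ χ ↦ ?_, ?_, fun x ↦ ?_, fun φ a h ↦ ?_⟩
  · change π (frac I t 0 1) = 1
    rw [hfrac₀, map_one, map_one]
  · exact hcomp φ _
  · exact hsurj.comp (evalOne_surjective hI ht)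
  · exact (hπ _).trans ((evalOneEquiv hI ht).map_smul_top_mem_iff I x)
  · change π (evalOne I t φ) = _
    rw [h, hfrac₀]

theorem flat_rightLinearEnd [IsNoetherianRing R] [Module.Flat R A] (hI : I.FG)
    (ht : ∀ a, a * t - t * a ∈ (I • ⊤ : Submodule R A)) : Module.Flat R (RightLinearEnd I t) := by
  have : Module.Flat R (LeftFractions R t) := Module.DirectLimit.flat _ _
  have := AdicCompletion.flat_of_flat I (LeftFractions R t)
  exact Module.Flat.of_linearEquiv (evalOneEquiv hI ht)

theorem isAdicComplete_rightLinearEnd (hI : I.FG)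
    (ht : ∀ a, a * t - t * a ∈ (I • ⊤ : Submodule R A)) :
    IsAdicComplete I (RightLinearEnd I t) := by
  have := AdicCompletion.isAdicComplete (M := LeftFractions R t) hI
  exact IsAdicComplete.of_linearEquiv (evalOneEquiv hI ht).symm

end CompletedFractions

end Augmentation

/-- Let `K` be a field, `(R, 𝔪)` a parameter `K`-algebra, `C` a
commutative `K`-algebra, `A` an associative `R`-deformation of `C` (a flat, `𝔪`-adically
complete, associative unital `R`-algebra with a surjective `K`-algebra augmentation
`ψ : A → C` whose kernel is `𝔪A`) and `τ : C → C'` a principal localization (`C'` is the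
localization of `C` away from an element `s`).  Then there exist an associative
`R`-deformation `A'` of `C'` and an `R`-algebra homomorphism `g : A → A'` lifting `τ`,
i.e. such that the augmentation `A' → C'` composed with `g` equals `τ` composed with
the augmentation `A → C`. -/
theorem stmt_4
    (K : Type u) [Field K]
    (R : Type u) [CommRing R] [Algebra K R] [IsLocalRing R] [IsNoetherianRing R]
    (hres : Function.Bijective (algebraMap K (IsLocalRing.ResidueField R)))
    [IsAdicComplete (IsLocalRing.maximalIdeal R) R]
    (C : Type u) [CommRing C] [Algebra K C]
    (A : Type u) [Ring A] [Algebra R A] [Algebra K A] [IsScalarTower K R A]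
    [Module.Flat R A] [IsAdicComplete (IsLocalRing.maximalIdeal R) A]
    (ψ : A →ₐ[K] C) (hψsurj : Function.Surjective ψ)
    (hψker : ∀ x : A, ψ x = 0 ↔ x ∈ (IsLocalRing.maximalIdeal R) • (⊤ : Submodule R A))
    (C' : Type u) [CommRing C'] [Algebra K C'] [Algebra C C'] [IsScalarTower K C C']
    (s : C) [IsLocalization.Away s C'] :
    ∃ (A' : Type u) (_ : Ring A') (_ : Algebra R A') (_ : Algebra K A')
        (_ : IsScalarTower K R A'),
      Module.Flat R A' ∧ IsAdicComplete (IsLocalRing.maximalIdeal R) A' ∧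
      ∃ (ψ' : A' →ₐ[K] C') (g : A →ₐ[R] A'),
        Function.Surjective ψ' ∧
        (∀ x : A', ψ' x = 0 ↔
          x ∈ (IsLocalRing.maximalIdeal R) • (⊤ : Submodule R A')) ∧
        (∀ x : A, ψ' (g x) = algebraMap C C' (ψ x)) := by
  have hI : (IsLocalRing.maximalIdeal R).FG := IsNoetherian.noetherian _
  let : Algebra R C := (ψ.toRingHom.comp (algebraMap R A)).toAlgebra
  let : Algebra R C' := ((algebraMap C C').comp (algebraMap R C)).toAlgebra
  have : IsScalarTower R C C' := .of_algebraMap_eq fun _ ↦ rfl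
  let ψR : A →ₐ[R] C := { ψ.toRingHom with commutes' _ := rfl }
  obtain ⟨t, rfl⟩ := hψsurj s
  have : IsLocalization.Away (ψR t) C' := ‹IsLocalization.Away (ψ t) C'›
  have ht (a : A) : a * t - t * a ∈ IsLocalRing.maximalIdeal R • (⊤ : Submodule R A) := by
    rw [← hψker, map_sub, map_mul, map_mul, mul_comm, sub_self]
  obtain ⟨ψ', hsurj, hker, hψ'⟩ := CompletedFractions.exists_algHom_augmentation
    (C' := C') (ψ := ψR) hI hψsurj hψker ht
  obtain ⟨g, hg⟩ := CompletedFractions.exists_algHom hI ht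
  let : Algebra K (CompletedFractions.RightLinearEnd (IsLocalRing.maximalIdeal R) t) :=
    Algebra.compHom _ (algebraMap K R)
  refine ⟨CompletedFractions.RightLinearEnd (IsLocalRing.maximalIdeal R) t, inferInstance,
    inferInstance, inferInstance, .of_algebraMap_eq fun _ ↦ rfl,
    CompletedFractions.flat_rightLinearEnd hI ht,
    CompletedFractions.isAdicComplete_rightLinearEnd hI ht,
    { ψ'.toRingHom with commutes' k := ?_ }, g, hsurj, hker, fun x ↦ hψ' (g x) x (hg x)⟩
  refine (ψ'.commutes (algebraMap K R k)).trans ?_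
  change algebraMap C C' (ψ (algebraMap R A (algebraMap K R k))) = _
  rw [← IsScalarTower.algebraMap_apply, ψ.commutes, ← IsScalarTower.algebraMap_apply]
end

section
/- Let K be a field, R a parameter K-algebra, C a commutative K-algebra, A an associative R-deformation of C, and τ : C → C' a principal localization. Then there exist an associative R-deformation A' of C' and an R-algebra homomorphism g : A → A' lifting τ, with the following universal property: for every commutative K-algebra C'' with a K-algebra homomorphism τ' : C' → C'', every associative R-deformation A'' of C'', and every R-algebra homomorphism h : A → A'' lifting τ'∘τ, there exists a unique R-algebra homomorphism g' : A' → A'' lifting τ' such that h = g'∘g. -/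
universe u

section Flatness

open TensorProduct

variable {R : Type*} [CommRing R]

theorem LinearMap.map_mem_smul_top {M N : Type*} [AddCommGroup M] [Module R M] [AddCommGroup N]
    [Module R N] (I : Ideal R) (f : M →ₗ[R] N) {x : M} (h : x ∈ I • (⊤ : Submodule R M)) :
    f x ∈ I • (⊤ : Submodule R N) := by
  have := Submodule.mem_map_of_mem (f := f) h
  rw [Submodule.map_smul''] at this
  exact Submodule.smul_mono le_rfl le_top this

theorem mem_smul_top_pi_iff {M : Type*} [AddCommGroup M] [Module R M] {ι : Type*} [Fintype ι]
    (I : Ideal R) (x : ι → M) :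
    x ∈ I • (⊤ : Submodule R (ι → M)) ↔ ∀ i, x i ∈ I • (⊤ : Submodule R M) := by
  classical
  refine ⟨fun h i => LinearMap.map_mem_smul_top I (LinearMap.proj i) h, fun h => ?_⟩
  rw [← Finset.univ_sum_single x]
  exact Submodule.sum_mem _ fun i _ =>
    LinearMap.map_mem_smul_top I (LinearMap.single R (fun _ => M) i) (h i)

/-- The linear map `Mᵏ → Mˡ` given by a matrix with entries in the base ring. -/
def matrixAct (M : Type*) [AddCommGroup M] [Module R M] {ι κ : Type*} [Fintype κ]
    (H : ι → κ → R) : (κ → M) →ₗ[R] (ι → M) :=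
  LinearMap.pi fun i => ∑ k, H i k • LinearMap.proj k

theorem matrixAct_apply {M : Type*} [AddCommGroup M] [Module R M] {ι κ : Type*} [Fintype κ]
    (H : ι → κ → R) (x : κ → M) (i : ι) : matrixAct M H x i = ∑ k, H i k • x k := by
  simp [matrixAct]

theorem map_matrixAct {M N : Type*} [AddCommGroup M] [Module R M] [AddCommGroup N] [Module R N]
    {ι κ : Type*} [Fintype κ] (f : M →ₗ[R] N) (H : ι → κ → R) (x : κ → M) (i : ι) :
    f (matrixAct M H x i) = matrixAct N H (fun k => f (x k)) i := by
  simp [matrixAct_apply]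

theorem piScalarRight_lTensor_matrixAct {M : Type*} [AddCommGroup M] [Module R M] {ι κ : Type*}
    [Fintype κ] [Fintype ι] [DecidableEq ι] [DecidableEq κ] (H : ι → κ → R)
    (w : M ⊗[R] (κ → R)) :
    piScalarRight R R M ι ((matrixAct R H).lTensor M w) =
      matrixAct M H (piScalarRight R R M κ w) := by
  induction w with
  | zero => simp
  | add x y hx hy => simp only [map_add, hx, hy]
  | tmul m f =>
    ext i
    simp [matrixAct_apply, Finset.sum_smul, mul_smul]

theorem exists_matrixAct_eq_of_flat [IsNoetherianRing R] (M : Type*) [AddCommGroup M] [Module R M]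
    [Module.Flat R M] {ι κ : Type*} [Fintype ι] [Fintype κ] (H : ι → κ → R) :
    ∃ (k : ℕ) (G : κ → Fin k → R), (∀ y, matrixAct R H (matrixAct R G y) = 0) ∧
      ∀ w : κ → M, matrixAct M H w = 0 → ∃ y, matrixAct M G y = w := by
  classical
  obtain ⟨k, f, hf⟩ := (Submodule.fg_iff_exists_fin_linearMap R (κ → R)).1
    (IsNoetherian.noetherian (LinearMap.ker (matrixAct R H)))
  have hG : matrixAct R (fun i j => f (Pi.single j 1) i) = f := by
    ext j i
    simp [matrixAct_apply, Pi.single_apply]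
  refine ⟨k, fun i j => f (Pi.single j 1) i, fun y => ?_, fun w hw => ?_⟩
  · rw [hG]
    have : f y ∈ LinearMap.ker (matrixAct R H) := hf ▸ LinearMap.mem_range_self f y
    exact this
  · have ex : Function.Exact f (matrixAct R H) := LinearMap.exact_iff.2 hf.symm
    have ex' := Module.Flat.lTensor_exact M ex
    obtain ⟨v, rfl⟩ := (piScalarRight R R M κ).surjective w
    rw [← piScalarRight_lTensor_matrixAct, LinearEquiv.map_eq_zero_iff] at hw
    obtain ⟨y, rfl⟩ := (ex' v).1 hw
    refine ⟨piScalarRight R R M (Fin k) y, ?_⟩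
    rw [← piScalarRight_lTensor_matrixAct, hG]

/-- A form of the Artin–Rees lemma: a linear map between finite modules over a noetherian ring,
tensored with a flat module, is strict for the adic filtrations up to a uniform shift. -/
theorem exists_artinRees_lTensor [IsNoetherianRing R] (I : Ideal R) (M : Type*) [AddCommGroup M]
    [Module R M] [Module.Flat R M] {X Y : Type*} [AddCommGroup X] [Module R X]
    [AddCommGroup Y] [Module R Y] [Module.Finite R Y] (H : X →ₗ[R] Y) :
    ∃ c : ℕ, ∀ n, ∀ w : M ⊗[R] X,
      H.lTensor M w ∈ I ^ (n + c) • (⊤ : Submodule R (M ⊗[R] Y)) →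
      ∃ w' ∈ I ^ n • (⊤ : Submodule R (M ⊗[R] X)), H.lTensor M w' = H.lTensor M w := by
  obtain ⟨c, hc⟩ := I.exists_pow_inf_eq_pow_smul (LinearMap.range H)
  refine ⟨c, fun n w hw => ?_⟩
  set J : Submodule R Y := I ^ (n + c) • ⊤
  have hkill : J.mkQ.lTensor M (H.lTensor M w) = 0 := by
    have h1 := LinearMap.map_mem_smul_top _ (J.mkQ.lTensor M) hw
    have h2 : I ^ (n + c) • (⊤ : Submodule R (M ⊗[R] (Y ⧸ J))) = ⊥ := by
      rw [eq_bot_iff, Submodule.smul_le]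
      intro r hr t _
      rw [Submodule.mem_bot]
      induction t with
      | zero => simp
      | add x y hx hy => rw [smul_add, hx trivial, hy trivial, add_zero]
      | tmul m q =>
        obtain ⟨y, rfl⟩ := J.mkQ_surjective q
        rw [← tmul_smul, ← map_smul]
        have : r • y ∈ J := Submodule.smul_mem_smul hr trivial
        rw [(Submodule.Quotient.mk_eq_zero J).2 this |> (fun h => (h : J.mkQ (r • y) = 0)),
          tmul_zero]
    rw [h2] at h1
    exact h1
  set D := LinearMap.ker (J.mkQ ∘ₗ H)
  have ex : Function.Exact D.subtype (J.mkQ ∘ₗ H) := by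
    rw [LinearMap.exact_iff, Submodule.range_subtype]
  obtain ⟨d, rfl⟩ := (Module.Flat.lTensor_exact M ex w).1 (by
    rw [LinearMap.lTensor_comp]; exact hkill)
  clear hw hkill
  induction d with
  | zero => exact ⟨0, zero_mem _, by simp⟩
  | add x y hx hy =>
    obtain ⟨a, ha, ha'⟩ := hx
    obtain ⟨b, hb, hb'⟩ := hy
    exact ⟨a + b, add_mem ha hb, by simp only [map_add, ha', hb']⟩
  | tmul m z =>
    have hz : H z ∈ I ^ (n + c) • (⊤ : Submodule R Y) ⊓ LinearMap.range H := by
      refine ⟨?_, LinearMap.mem_range_self H _⟩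
      have := z.2
      rw [LinearMap.mem_ker, LinearMap.comp_apply, Submodule.mkQ_apply,
        Submodule.Quotient.mk_eq_zero] at this
      exact this
    rw [hc _ (Nat.le_add_left _ _), Nat.add_sub_cancel] at hz
    have hz' : H z ∈ Submodule.map H (I ^ n • ⊤) := by
      rw [Submodule.map_smul'', Submodule.map_top]
      exact Submodule.smul_mono le_rfl inf_le_right hz
    obtain ⟨x, hx, hxz⟩ := hz'
    refine ⟨m ⊗ₜ x, LinearMap.map_mem_smul_top _ (TensorProduct.mk R M X m) hx, ?_⟩
    simp [hxz]

theorem exists_artinRees_matrixAct [IsNoetherianRing R] (I : Ideal R) (M : Type*) [AddCommGroup M]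
    [Module R M] [Module.Flat R M] {ι κ : Type*} [Fintype ι] [Fintype κ] (H : ι → κ → R) :
    ∃ c : ℕ, ∀ n, ∀ w : κ → M,
      (∀ i, matrixAct M H w i ∈ I ^ (n + c) • (⊤ : Submodule R M)) →
      ∃ w' : κ → M, (∀ k, w' k ∈ I ^ n • (⊤ : Submodule R M)) ∧
        matrixAct M H w' = matrixAct M H w := by
  classical
  obtain ⟨c, hc⟩ := exists_artinRees_lTensor I M (matrixAct R H)
  refine ⟨c, fun n w hw => ?_⟩
  obtain ⟨v, rfl⟩ := (piScalarRight R R M κ).surjective w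
  rw [← mem_smul_top_pi_iff, ← piScalarRight_lTensor_matrixAct] at hw
  obtain ⟨w', hw', e⟩ := hc n v (by
    have := LinearMap.map_mem_smul_top _ (piScalarRight R R M ι).symm.toLinearMap hw
    rwa [LinearEquiv.coe_coe, LinearEquiv.symm_apply_apply] at this)
  refine ⟨piScalarRight R R M κ w', ?_, ?_⟩
  · rw [← mem_smul_top_pi_iff]
    exact LinearMap.map_mem_smul_top _ (piScalarRight R R M κ).toLinearMap hw'
  · rw [← piScalarRight_lTensor_matrixAct, e, piScalarRight_lTensor_matrixAct]

/-- Over a noetherian ring, an adically complete module containing a dense image of a flat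
module with the induced filtration is flat. -/
theorem Module.Flat.of_dense [IsNoetherianRing R] (I : Ideal R) {M P : Type*} [AddCommGroup M]
    [Module R M] [Module.Flat R M] [AddCommGroup P] [Module R P] [IsAdicComplete I P]
    (e : M →ₗ[R] P)
    (dense : ∀ (x : P) (n : ℕ), ∃ a, x - e a ∈ I ^ n • (⊤ : Submodule R P))
    (strict : ∀ (a : M) (n : ℕ), e a ∈ I ^ n • (⊤ : Submodule R P) →
      a ∈ I ^ n • (⊤ : Submodule R M)) :
    Module.Flat R P := by
  refine Module.Flat.of_forall_isTrivialRelation fun {l f x} hfx => ?_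
  set F : Unit → Fin l → R := fun _ => f
  obtain ⟨k, G, hFG, hG⟩ := exists_matrixAct_eq_of_flat M F
  obtain ⟨c, hc⟩ := exists_artinRees_matrixAct I M F
  obtain ⟨c', hc'⟩ := exists_artinRees_matrixAct I M G
  have hx : matrixAct P F x = 0 := by
    ext i; simpa [matrixAct_apply, F] using hfx
  have mono : ∀ {m n : ℕ}, m ≤ n →
      I ^ n • (⊤ : Submodule R P) ≤ I ^ m • (⊤ : Submodule R P) := fun h =>
    Submodule.smul_mono_left (Ideal.pow_le_pow_right h)
  have approx : ∀ n, ∃ y : Fin k → M,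
      x - matrixAct P G (fun j => e (y j)) ∈ I ^ n • (⊤ : Submodule R (Fin l → P)) := by
    intro n
    choose a ha using fun i => dense (x i) (n + c)
    have hxa : x - (fun i => e (a i)) ∈ I ^ (n + c) • (⊤ : Submodule R (Fin l → P)) := by
      rw [mem_smul_top_pi_iff]; exact ha
    obtain ⟨w', hw', e'⟩ := hc n a (fun i => by
      apply strict
      rw [map_matrixAct]
      have := LinearMap.map_mem_smul_top _ (matrixAct P F) hxa
      rw [map_sub, hx, zero_sub, neg_mem_iff, mem_smul_top_pi_iff] at this
      exact this i)
    obtain ⟨y, hy⟩ := hG (a - w') (by rw [map_sub, e', sub_self])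
    refine ⟨y, ?_⟩
    rw [mem_smul_top_pi_iff]
    intro i
    have : (x - matrixAct P G (fun j => e (y j))) i = (x i - e (a i)) + e (w' i) := by
      rw [Pi.sub_apply, ← map_matrixAct, hy, Pi.sub_apply, map_sub]; abel
    rw [this]
    exact add_mem (mono (Nat.le_add_right _ _) (ha i)) (LinearMap.map_mem_smul_top _ e (hw' i))
  choose y hy using fun n => approx (n + c')
  have step : ∀ n, ∃ d : Fin k → M, (∀ j, d j ∈ I ^ n • (⊤ : Submodule R M)) ∧
      matrixAct M G d = matrixAct M G (y (n + 1) - y n) := by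
    intro n
    refine hc' n _ fun i => strict _ _ ?_
    rw [map_matrixAct]
    have h1 := sub_mem (hy n)
      (Submodule.smul_mono_left (Ideal.pow_le_pow_right (by omega)) (hy (n + 1)) :
        _ ∈ I ^ (n + c') • (⊤ : Submodule R (Fin l → P)))
    rw [sub_sub_sub_cancel_left, ← map_sub, mem_smul_top_pi_iff] at h1
    have h2 : (fun j => e ((y (n + 1) - y n) j)) =
        (fun j => e (y (n + 1) j)) - fun j => e (y n j) := by funext j; simp
    rw [h2]
    exact h1 i
  choose d hd hGd using step
  set Y : ℕ → Fin k → M := fun n => y 0 + ∑ j ∈ Finset.range n, d j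
  have hY : ∀ n, matrixAct M G (Y n) = matrixAct M G (y n) := by
    intro n
    simp only [Y, map_add, map_sum, hGd, map_sub]
    rw [Finset.sum_range_sub (fun n => matrixAct M G (y n))]
    abel
  have cauchy : ∀ j, ∃ L : P, ∀ n, e (Y n j) ≡ L [SMOD I ^ n • (⊤ : Submodule R P)] := by
    intro j
    refine IsPrecomplete.prec' _ fun {m n} h => ?_
    refine ((AdicCompletion.isAdicCauchy_iff I P (fun n => e (Y n j))).2 fun n => ?_) h
    rw [SModEq.sub_mem]
    simp only [Y, Finset.sum_range_succ, ← add_assoc, Pi.add_apply, map_add]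
    rw [sub_add_cancel_left, neg_mem_iff]
    exact LinearMap.map_mem_smul_top _ e (hd n j)
  choose L hL using cauchy
  have hx' : matrixAct P G L = x := by
    funext i
    refine IsHausdorff.eq_iff_smodEq (I := I) |>.2 fun n => ?_
    rw [SModEq.sub_mem]
    have h1 : (fun j => e (Y n j)) - L ∈ I ^ n • (⊤ : Submodule R (Fin k → P)) := by
      rw [mem_smul_top_pi_iff]; exact fun j => SModEq.sub_mem.1 (hL j n)
    have h2 := LinearMap.map_mem_smul_top _ (matrixAct P G) h1
    have h3 : matrixAct P G (fun j => e (Y n j)) = matrixAct P G (fun j => e (y n j)) := by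
      funext i; rw [← map_matrixAct, hY, map_matrixAct]
    have h4 : x - matrixAct P G (fun j => e (y n j)) ∈ I ^ n • (⊤ : Submodule R (Fin l → P)) :=
      Submodule.smul_mono_left (Ideal.pow_le_pow_right (by omega)) (hy n)
    have h5 := add_mem h4 h2
    rw [map_sub, h3, sub_add_sub_cancel, ← neg_mem_iff, neg_sub, mem_smul_top_pi_iff] at h5
    exact h5 i
  refine ⟨k, G, L, fun i => by rw [← hx', matrixAct_apply], fun j => ?_⟩
  simpa [matrixAct_apply, F, Pi.single_apply] using congrFun (hFG (Pi.single j 1)) ()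

end Flatness

section Completeness

variable {R : Type*} [CommRing R]

theorem IsAdicComplete.of_linearEquiv_s5 {I : Ideal R} {M N : Type*} [AddCommGroup M] [Module R M]
    [AddCommGroup N] [Module R N] [IsAdicComplete I M] (e : N ≃ₗ[R] M) : IsAdicComplete I N where
  haus' x hx := by
    rw [← LinearEquiv.map_eq_zero_iff e]
    refine IsHausdorff.haus' (I := I) _ fun n => ?_
    rw [SModEq.zero]
    exact LinearMap.map_mem_smul_top _ e.toLinearMap (SModEq.zero.1 (hx n))
  prec' f hf := by
    obtain ⟨L, hL⟩ := IsPrecomplete.prec' (I := I) (fun n => e (f n)) fun {m n} h => by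
      rw [SModEq.sub_mem, ← map_sub]
      exact LinearMap.map_mem_smul_top _ e.toLinearMap (SModEq.sub_mem.1 (hf h))
    refine ⟨e.symm L, fun n => ?_⟩
    have := LinearMap.map_mem_smul_top _ e.symm.toLinearMap (SModEq.sub_mem.1 (hL n))
    rw [SModEq.sub_mem]
    simpa using this

/-- A module which is the inverse limit of the quotients `M ⧸ Iⁿ M` (presented as modules `B n`)
is `I`-adically complete, and its quotient by `Iⁿ` is again `B n`. -/
theorem isAdicComplete_of_tower {I : Ideal R} (hI : I.FG) {M : Type*} [AddCommGroup M] [Module R M]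
    {B : ℕ → Type*} [∀ n, AddCommGroup (B n)] [∀ n, Module R (B n)]
    (p : ∀ n, M →ₗ[R] B n) (hp : ∀ n, Function.Surjective (p n))
    (hker : ∀ n x, p n x = 0 ↔ x ∈ I ^ n • (⊤ : Submodule R M))
    {P : Type*} [AddCommGroup P] [Module R P] (q : ∀ n, P →ₗ[R] B n)
    (hinj : ∀ a, (∀ n, q n a = 0) → a = 0)
    (hcompat : ∀ n a x, q (n + 1) a = p (n + 1) x → q n a = p n x)
    (hlift : ∀ x : ℕ → M, (∀ n, p n (x (n + 1)) = p n (x n)) → ∃ a, ∀ n, q n a = p n (x n)) :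
    IsAdicComplete I P ∧ ∀ n a, q n a = 0 ↔ a ∈ I ^ n • (⊤ : Submodule R P) := by
  have hker' : ∀ n, I ^ n • (⊤ : Submodule R M) = LinearMap.ker (p n) := fun n => by
    ext x; rw [LinearMap.mem_ker, hker]
  let θ : ∀ n, (M ⧸ (I ^ n • (⊤ : Submodule R M))) ≃ₗ[R] B n := fun n =>
    (Submodule.quotEquivOfEq _ _ (hker' n)).trans ((p n).quotKerEquivOfSurjective (hp n))
  have hθ : ∀ n x, (θ n).symm (p n x) = Submodule.Quotient.mk x := fun n x => by
    rw [LinearEquiv.symm_apply_eq]; rfl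
  have hcompat' : ∀ {m n : ℕ}, m ≤ n → ∀ a x, q n a = p n x → q m a = p m x := by
    intro m n h a x
    induction n, h using Nat.le_induction with
    | base => exact id
    | succ n _ ih => exact fun h => ih (hcompat _ _ _ h)
  let e : P →ₗ[R] AdicCompletion I M :=
    { toFun := fun a => ⟨fun n => (θ n).symm (q n a), fun {m n} h => by
        obtain ⟨x, hx⟩ := hp n (q n a)
        change AdicCompletion.transitionMap I M h ((θ n).symm (q n a)) = (θ m).symm (q m a)
        rw [hcompat' h a x hx.symm, ← hx, hθ, hθ]
        rfl⟩
      map_add' := fun a b => AdicCompletion.ext fun n => by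
        change (θ n).symm (q n (a + b)) = (θ n).symm (q n a) + (θ n).symm (q n b)
        rw [map_add, map_add]
      map_smul' := fun r a => AdicCompletion.ext fun n => by
        change (θ n).symm (q n (r • a)) = r • (θ n).symm (q n a)
        rw [map_smul, map_smul] }
  have he : ∀ a n, AdicCompletion.eval I M n (e a) = (θ n).symm (q n a) := fun a n => rfl
  have bij : Function.Bijective e := by
    constructor
    · rw [injective_iff_map_eq_zero]
      intro a ha
      refine hinj a fun n => ?_
      have := he a n
      rw [ha, map_zero] at this
      exact (LinearEquiv.map_eq_zero_iff _).1 this.symm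
    · intro y
      choose x hx using fun n => Submodule.Quotient.mk_surjective _ (AdicCompletion.eval I M n y)
      obtain ⟨a, ha⟩ := hlift x fun n => by
        rw [← sub_eq_zero, ← map_sub, hker, ← Submodule.Quotient.mk_eq_zero,
          Submodule.Quotient.mk_sub, sub_eq_zero, hx n]
        refine Eq.trans ?_ (AdicCompletion.transitionMap_comp_eval_apply I M (Nat.le_succ n) y)
        exact congrArg (AdicCompletion.transitionMap I M (Nat.le_succ n)) (hx (n + 1))
      refine ⟨a, AdicCompletion.ext fun n => ?_⟩
      rw [← AdicCompletion.eval_apply, ← AdicCompletion.eval_apply, he, ha, hθ, hx]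
  let E := LinearEquiv.ofBijective e bij
  have := AdicCompletion.isAdicComplete (I := I) (M := M) hI
  refine ⟨IsAdicComplete.of_linearEquiv_s5 E, fun n a => ⟨fun h => ?_, fun h => ?_⟩⟩
  · have h1 : e a ∈ I ^ n • (⊤ : Submodule R (AdicCompletion I M)) := by
      rw [AdicCompletion.pow_smul_top_eq_ker_eval hI, LinearMap.mem_ker, he, h, map_zero]
    have := LinearMap.map_mem_smul_top _ E.symm.toLinearMap h1
    have h2 : E.symm (e a) = a := E.symm_apply_apply a
    rwa [LinearEquiv.coe_coe, h2] at this
  · have h1 := LinearMap.map_mem_smul_top _ e h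
    rw [AdicCompletion.pow_smul_top_eq_ker_eval hI, LinearMap.mem_ker, he] at h1
    exact (LinearEquiv.map_eq_zero_iff _).1 h1

end Completeness

section Telescope

variable {R : Type u} [CommRing R] {N : Type u} [AddCommGroup N] [Module R N]

/-- The colimit of the sequence `N → N → N → ⋯` given by iterating an endomorphism. -/
theorem exists_telescope (t : Module.End R N) :
    ∃ (M : Type u) (_ : AddCommGroup M) (_ : Module R M) (u : ℕ → N →ₗ[R] M),
      (∀ x, ∃ k a, u k a = x) ∧ (∀ k a, u (k + 1) (t a) = u k a) ∧
      (∀ k a, u k a = 0 → ∃ l, (t ^ l) a = 0) ∧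
      ∀ (B : Type u) [AddCommGroup B] [Module R B] (g : ℕ → N →ₗ[R] B),
        (∀ k a, g (k + 1) (t a) = g k a) → ∃ p : M →ₗ[R] B, ∀ k a, p (u k a) = g k a := by
  let f : ∀ i j : ℕ, i ≤ j → N →ₗ[R] N := fun i j _ => t ^ (j - i)
  have : DirectedSystem (fun _ : ℕ => N) (fun i j h => f i j h) :=
    { map_self := fun i x => by simp [f]
      map_map := fun i j k hij hjk x => by
        rw [← Module.End.mul_apply]
        simp only [f]
        rw [← pow_add]
        congr 2
        omega }
  refine ⟨Module.DirectLimit (fun _ => N) f, inferInstance, inferInstance,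
    fun k => Module.DirectLimit.of R ℕ (fun _ => N) f k, fun x => ?_, fun k a => ?_,
    fun k a h => ?_, fun B _ _ g hg => ?_⟩
  · obtain ⟨k, a, h⟩ := Module.DirectLimit.exists_of x
    exact ⟨k, a, h⟩
  · have := Module.DirectLimit.of_f (R := R) (G := fun _ : ℕ => N) (f := f)
      (hij := Nat.le_succ k) (x := a)
    simpa [f] using this
  · obtain ⟨j, hj, h⟩ := Module.DirectLimit.of.zero_exact h
    exact ⟨_, h⟩
  · have hg' : ∀ i l a, g (i + l) ((t ^ l) a) = g i a := by
      intro i l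
      induction l with
      | zero => simp
      | succ l ih => intro a; rw [pow_succ', Module.End.mul_apply, ← add_assoc, hg, ih]
    refine ⟨Module.DirectLimit.lift R ℕ (fun _ => N) f g fun i j h a => ?_, fun k a => ?_⟩
    · obtain ⟨l, rfl⟩ := Nat.exists_eq_add_of_le h
      simp [f, hg']
    · exact Module.DirectLimit.lift_of g _ a

variable {M : Type u} [AddCommGroup M] [Module R M] {t : Module.End R N} {u : ℕ → N →ₗ[R] M}

theorem telescope_pow (hstep : ∀ k a, u (k + 1) (t a) = u k a) (k l : ℕ) (a : N) :
    u (k + l) ((t ^ l) a) = u k a := by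
  induction l with
  | zero => simp
  | succ l ih => rw [pow_succ', Module.End.mul_apply, ← add_assoc, hstep, ih]

theorem Module.Flat.of_telescope [Module.Flat R N] (hsurj : ∀ x, ∃ k a, u k a = x)
    (hstep : ∀ k a, u (k + 1) (t a) = u k a) (hzero : ∀ k a, u k a = 0 → ∃ l, (t ^ l) a = 0) :
    Module.Flat R M := by
  refine Module.Flat.of_forall_isTrivialRelation fun {l f x} hfx => ?_
  choose k a ha using fun i => hsurj (x i)
  set n := ∑ i, k i
  have ha' : ∀ i, u n ((t ^ (n - k i)) (a i)) = x i := fun i => by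
    have hn : n = k i + (n - k i) :=
      (Nat.add_sub_of_le (Finset.single_le_sum (fun _ _ => Nat.zero_le _) (Finset.mem_univ i))).symm
    conv_lhs => rw [hn]
    rw [Nat.add_sub_cancel_left, telescope_pow hstep, ha]
  obtain ⟨r, hr⟩ := hzero n (∑ i, f i • (t ^ (n - k i)) (a i)) (by simp [ha', hfx])
  simp only [map_sum, map_smul] at hr
  obtain ⟨m, b, y, hy, hb⟩ := Module.Flat.isTrivialRelation_of_sum_smul_eq_zero hr
  refine ⟨m, b, fun j => u (n + r) (y j), fun i => ?_, hb⟩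
  rw [← ha', ← telescope_pow hstep n r]
  refine (congrArg (u (n + r)) (hy i)).trans ?_
  simp

end Telescope

section OreLocalization

/-- The powers of an element whose inner derivation is locally nilpotent satisfy the Ore
condition. -/
theorem nonempty_oreSet_powers {Q : Type*} [Ring Q] (s : Q)
    (hs : ∀ a, ∃ n, (fun x => s * x - x * s)^[n] a = 0) :
    Nonempty (OreLocalization.OreSet (Submonoid.powers s)) := by
  have right_cancel : ∀ n a, (fun x => s * x - x * s)^[n] a = 0 → a * s = 0 →
      ∃ k, s ^ k * a = 0 := by
    intro n
    induction n with
    | zero => exact fun a ha _ => ⟨0, by simpa using ha⟩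
    | succ n ih =>
      intro a ha has
      rw [Function.iterate_succ_apply, has, sub_zero] at ha
      obtain ⟨k, hk⟩ := ih (s * a) ha (by rw [mul_assoc, has, mul_zero])
      exact ⟨k + 1, by rw [pow_succ, mul_assoc, hk]⟩
  have right_cancel_pow : ∀ k a, a * s ^ k = 0 → ∃ l, s ^ l * a = 0 := by
    intro k
    induction k with
    | zero => exact fun a ha => ⟨0, by simpa using ha⟩
    | succ k ih =>
      intro a ha
      rw [pow_succ, ← mul_assoc] at ha
      obtain ⟨n, hn⟩ := hs (a * s ^ k)
      obtain ⟨l, hl⟩ := right_cancel n _ hn ha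
      obtain ⟨l', hl'⟩ := ih (s ^ l * a) (by rw [mul_assoc, hl])
      exact ⟨l' + l, by rw [pow_add, mul_assoc, hl']⟩
  have exchange : ∀ n a, (fun x => s * x - x * s)^[n] a = 0 → ∃ a', s ^ n * a = a' * s := by
    intro n
    induction n with
    | zero => exact fun a ha => ⟨0, by simpa using ha⟩
    | succ n ih =>
      intro a ha
      obtain ⟨a', h⟩ := ih _ ha
      refine ⟨a' + s ^ n * a, ?_⟩
      rw [add_mul, ← h, mul_sub, pow_succ, mul_assoc, mul_assoc, sub_add_cancel]
  have exchange_pow : ∀ a k, ∃ l a', s ^ l * a = a' * s ^ k := by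
    intro a k
    induction k with
    | zero => exact ⟨0, a, by simp⟩
    | succ k ih =>
      obtain ⟨l, a', h⟩ := ih
      obtain ⟨n, hn⟩ := hs a'
      obtain ⟨a'', h'⟩ := exchange n a' hn
      exact ⟨n + l, a'', by rw [pow_add, mul_assoc, h, ← mul_assoc, h', mul_assoc, ← pow_succ']⟩
  rw [OreLocalization.nonempty_oreSet_iff]
  constructor
  · rintro r₁ r₂ ⟨_, k, rfl⟩ h
    obtain ⟨l, hl⟩ := right_cancel_pow k (r₁ - r₂) (by rw [sub_mul, sub_eq_zero]; exact h)
    refine ⟨⟨s ^ l, l, rfl⟩, ?_⟩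
    rwa [mul_sub, sub_eq_zero] at hl
  · rintro r ⟨_, k, rfl⟩
    obtain ⟨l, a', h⟩ := exchange_pow r k
    exact ⟨a', ⟨s ^ l, l, rfl⟩, h⟩

variable {R : Type u} [CommRing R] {A : Type u} [Ring A] [Algebra R A]

theorem mul_mem_smul_top (I : Ideal R) (a : A) {x : A} (hx : x ∈ I • (⊤ : Submodule R A)) :
    a * x ∈ I • (⊤ : Submodule R A) :=
  LinearMap.map_mem_smul_top I (LinearMap.mulLeft R a) hx

theorem mem_smul_top_mul (I : Ideal R) (a : A) {x : A} (hx : x ∈ I • (⊤ : Submodule R A)) :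
    x * a ∈ I • (⊤ : Submodule R A) :=
  LinearMap.map_mem_smul_top I (LinearMap.mulRight R a) hx

variable (A) in
/-- The extension of an ideal of the base ring to an algebra, as a left ideal. -/
def extendedIdeal (I : Ideal R) : Ideal A where
  toAddSubmonoid := (I • (⊤ : Submodule R A)).toAddSubmonoid
  smul_mem' a _ hx := mul_mem_smul_top I a hx

instance (I : Ideal R) : (extendedIdeal A I).IsTwoSided where
  mul_mem_of_left a hx := mem_smul_top_mul I a hx

theorem iterate_commutator_mem {I : Ideal R} {s : A}
    (hs : ∀ a, s * a - a * s ∈ I • (⊤ : Submodule R A)) (n : ℕ) (a : A) :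
    (fun x => s * x - x * s)^[n] a ∈ I ^ n • (⊤ : Submodule R A) := by
  induction n with
  | zero => simp
  | succ n ih =>
    rw [Function.iterate_succ_apply']
    let d : A →ₗ[R] A := LinearMap.mulLeft R s - LinearMap.mulRight R s
    have h := Submodule.mem_map_of_mem (f := d) ih
    rw [Submodule.map_smul'', Submodule.map_top] at h
    rw [pow_succ, Submodule.mul_smul]
    refine Submodule.smul_mono le_rfl ?_ h
    rintro _ ⟨x, rfl⟩
    exact hs x

/-- If `s` is central modulo `I`, it can be inverted modulo `I ^ n`. -/
theorem exists_localization_mod_pow (I : Ideal R) (s : A)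
    (hs : ∀ a, s * a - a * s ∈ I • (⊤ : Submodule R A)) (n : ℕ) :
    ∃ (B : Type u) (_ : Ring B) (_ : Algebra R B) (j : A →ₐ[R] B),
      IsUnit (j s) ∧ (∀ b, ∃ k a, j s ^ k * b = j a) ∧
      (∀ a, j a = 0 ↔ ∃ k, s ^ k * a ∈ I ^ n • (⊤ : Submodule R A)) ∧
      ∀ (T : Type u) [Ring T] (f : A →+* T), (∀ a ∈ I ^ n • (⊤ : Submodule R A), f a = 0) →
        IsUnit (f s) → ∃ F : B →+* T, ∀ a, F (j a) = f a := by
  let J := extendedIdeal A (I ^ n)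
  let Q := A ⧸ J
  let π : A →ₐ[R] Q := Ideal.Quotient.mkₐ R J
  have hπ : ∀ a, π a = 0 ↔ a ∈ I ^ n • (⊤ : Submodule R A) := fun a =>
    Ideal.Quotient.eq_zero_iff_mem
  have hπs : Function.Surjective π := Ideal.Quotient.mk_surjective
  have hit : ∀ k a, (fun x => π s * x - x * π s)^[k] (π a) =
      π ((fun x => s * x - x * s)^[k] a) := by
    intro k
    induction k with
    | zero => simp
    | succ k ih =>
      intro a
      rw [Function.iterate_succ_apply, Function.iterate_succ_apply, ← ih]
      simp
  obtain ⟨ore⟩ := nonempty_oreSet_powers (π s) fun a => by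
    obtain ⟨a, rfl⟩ := hπs a
    exact ⟨n, by rw [hit, hπ]; exact iterate_commutator_mem hs n a⟩
  let S := Submonoid.powers (π s)
  let B := OreLocalization S Q
  let ν : Q →ₐ[R] B :=
    { (OreLocalization.numeratorRingHom : Q →+* B) with commutes' := fun r => rfl }
  have hν : ∀ q, ν q = OreLocalization.oreDiv q (1 : S) := fun q => rfl
  let σ : S := ⟨π s, Submonoid.mem_powers _⟩
  have hσ : IsUnit (ν (π s)) := OreLocalization.numerator_isUnit σ
  refine ⟨B, inferInstance, inferInstance, ν.comp π, hσ, fun b => ?_, fun a => ?_,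
    fun T _ f hf hfs => ?_⟩
  · induction b using OreLocalization.ind with
    | _ r t =>
      obtain ⟨_, k, rfl⟩ := t
      obtain ⟨a, rfl⟩ := hπs r
      refine ⟨k, a, ?_⟩
      rw [AlgHom.comp_apply, AlgHom.comp_apply, ← map_pow, hν, hν]
      exact OreLocalization.mul_cancel (s := (⟨π s ^ k, k, rfl⟩ : S)) (t := 1)
  · rw [AlgHom.comp_apply]
    constructor
    · intro h
      rw [← map_zero ν, hν, hν, OreLocalization.oreDiv_eq_iff] at h
      obtain ⟨⟨_, k, rfl⟩, v, h1, h2⟩ := h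
      refine ⟨k, ?_⟩
      simp only [smul_zero, Submonoid.coe_one, mul_one, smul_eq_mul] at h1 h2
      rw [← hπ, map_mul, map_pow, h1]
      exact congrArg (· * π a) h2
    · rintro ⟨k, hk⟩
      rw [← hπ, map_mul, map_pow] at hk
      have := congrArg ν hk
      rw [map_zero, map_mul, map_pow] at this
      exact (hσ.pow k).mul_right_eq_zero.1 this
  · let f' : Q →+* T := Ideal.Quotient.lift J f hf
    have hf' : ∀ t : S, IsUnit ((f' : Q →* T).comp S.subtype t) := by
      rintro ⟨_, k, rfl⟩
      change IsUnit (f' (π s ^ k))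
      rw [map_pow]
      exact IsUnit.pow k hfs
    refine ⟨OreLocalization.universalHom f' (IsUnit.liftRight _ hf') fun t => ?_, fun a => ?_⟩
    · rw [IsUnit.coe_liftRight]; rfl
    · exact OreLocalization.universalHom_commutes _ _ _

end OreLocalization

section CompletedLocalization

variable {R : Type u} [CommRing R] {A : Type u} [Ring A] [Algebra R A]

/-- The completed localization of a flat algebra at an element which is central modulo `I`. -/
theorem exists_completed_localization [IsNoetherianRing R] [Module.Flat R A] (I : Ideal R) (s : A)
    (hs : ∀ a, s * a - a * s ∈ I • (⊤ : Submodule R A)) :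
    ∃ (A' : Type u) (_ : Ring A') (_ : Algebra R A') (g : A →ₐ[R] A') (σ : A'),
      Module.Flat R A' ∧ IsAdicComplete I A' ∧ g s * σ = 1 ∧ σ * g s = 1 ∧
      (∀ n b, ∃ k a, b - σ ^ k * g a ∈ I ^ n • (⊤ : Submodule R A')) ∧
      (∀ n k a, σ ^ k * g a ∈ I ^ n • (⊤ : Submodule R A') →
        ∃ l, s ^ l * a ∈ I ^ n • (⊤ : Submodule R A)) ∧
      ∀ (n : ℕ) (T : Type u) [Ring T] (f : A →+* T),
        (∀ a ∈ I ^ n • (⊤ : Submodule R A), f a = 0) → IsUnit (f s) →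
        ∃ F : A' →+* T, (∀ a, F (g a) = f a) ∧
          ∀ b ∈ I ^ n • (⊤ : Submodule R A'), F b = 0 := by
  choose B _ _ j hj hfrac hker huniv using exists_localization_mod_pow I s hs
  have hj0 : ∀ n a, a ∈ I ^ n • (⊤ : Submodule R A) → j n a = 0 := fun n a ha =>
    (hker n a).2 ⟨0, by simpa using ha⟩
  choose v hv hv' using fun n => isUnit_iff_exists.1 (hj n)
  choose π hπ using fun n => huniv (n + 1) (B n) (j n : A →+* B n)
    (fun a ha => hj0 n a (Submodule.smul_mono_left (Ideal.pow_le_pow_right n.le_succ) ha)) (hj n)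
  replace hπ : ∀ n a, π n (j (n + 1) a) = j n a := hπ
  have hvpow : ∀ n k, v n ^ k * j n s ^ k = 1 := fun n k => by
    have hc : Commute (v n) (j n s) := (hv' n).trans (hv n).symm
    rw [← hc.mul_pow, hv', one_pow]
  have hπv : ∀ n, π n (v (n + 1)) = v n := fun n => by
    refine left_inv_eq_right_inv (a := j n s) ?_ (hv n)
    rw [← hπ, ← map_mul, hv', map_one]
  obtain ⟨M, _, _, u, husurj, hustep, huzero, hulift⟩ :=
    exists_telescope (LinearMap.mulLeft R s)
  have hflat : Module.Flat R M := Module.Flat.of_telescope husurj hustep huzero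
  choose p hp using fun n => hulift (B n)
    (fun k => LinearMap.mulLeft R (v n ^ k) ∘ₗ (j n).toLinearMap) fun k a => by
      simp only [LinearMap.comp_apply, LinearMap.mulLeft_apply, AlgHom.toLinearMap_apply, map_mul]
      rw [← mul_assoc, pow_succ, mul_assoc (v n ^ k), hv', mul_one]
  replace hp : ∀ n k a, p n (u k a) = v n ^ k * j n a := hp
  have hpsurj : ∀ n, Function.Surjective (p n) := fun n b => by
    obtain ⟨k, a, h⟩ := hfrac n b
    exact ⟨u k a, by rw [hp, ← h, ← mul_assoc, hvpow, one_mul]⟩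
  have hpzero : ∀ n k a, p n (u k a) = 0 ↔ ∃ l, s ^ l * a ∈ I ^ n • (⊤ : Submodule R A) := by
    intro n k a
    rw [hp, ← hker]
    refine ⟨fun h => ?_, fun h => by rw [h, mul_zero]⟩
    have hu : IsUnit (v n) := isUnit_iff_exists.2 ⟨_, hv' n, hv n⟩
    exact (hu.pow k).mul_right_eq_zero.1 h
  have hpker : ∀ n x, p n x = 0 ↔ x ∈ I ^ n • (⊤ : Submodule R M) := by
    intro n x
    constructor
    · obtain ⟨k, a, rfl⟩ := husurj x
      rw [hpzero]
      rintro ⟨l, hl⟩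
      rw [← telescope_pow hustep k l, LinearMap.pow_mulLeft]
      exact LinearMap.map_mem_smul_top _ _ hl
    · intro hx
      refine Submodule.smul_induction_on hx (fun r hr y _ => ?_) fun x y hx hy => by
        rw [map_add, hx, hy, add_zero]
      obtain ⟨k, a, rfl⟩ := husurj y
      rw [← map_smul, hp, hj0 n _ (Submodule.smul_mem_smul hr trivial), mul_zero]
  have hπp : ∀ n x, π n (p (n + 1) x) = p n x := fun n x => by
    obtain ⟨k, a, rfl⟩ := husurj x
    rw [hp, hp, map_mul, map_pow, hπv, hπ]
  let A' : Subalgebra R (∀ n, B n) :=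
    { carrier := {b | ∀ n, π n (b (n + 1)) = b n}
      mul_mem' := fun ha hb n => by
        rw [Pi.mul_apply, Pi.mul_apply, map_mul, ha, hb]
      add_mem' := fun ha hb n => by
        rw [Pi.add_apply, Pi.add_apply, map_add, ha, hb]
      algebraMap_mem' := fun r n => by
        rw [Pi.algebraMap_apply, Pi.algebraMap_apply, ← (j _).commutes, hπ, (j _).commutes] }
  let q : ∀ n, A' →ₗ[R] B n := fun n => LinearMap.proj n ∘ₗ A'.val.toLinearMap
  let ι : M →ₗ[R] A' :=
    { toFun := fun x => ⟨fun n => p n x, fun n => hπp n x⟩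
      map_add' := fun x y => Subtype.ext <| funext fun n => map_add (p n) x y
      map_smul' := fun r x => Subtype.ext <| funext fun n => map_smul (p n) r x }
  have hqι : ∀ n x, q n (ι x) = p n x := fun n x => rfl
  obtain ⟨hcomplete, hq⟩ := isAdicComplete_of_tower (IsNoetherian.noetherian I) p hpsurj hpker q
    (fun a ha => Subtype.ext <| funext ha)
    (fun n a x h => by rw [← hπp, ← h]; exact (a.2 n).symm)
    (fun x hx => ⟨⟨fun n => p n (x n), fun n => by rw [hπp, hx]⟩, fun n => rfl⟩)
  have hdense : ∀ b n, ∃ x, b - ι x ∈ I ^ n • (⊤ : Submodule R A') := fun b n => by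
    obtain ⟨x, hx⟩ := hpsurj n (q n b)
    exact ⟨x, by rw [← hq, map_sub, hqι, hx, sub_self]⟩
  let g : A →ₐ[R] A' := (AlgHom.pi j).codRestrict A' fun a n => hπ n a
  let σ : A' := ⟨v, hπv⟩
  have hσ : ∀ k a, σ ^ k * g a = ι (u k a) := fun k a =>
    Subtype.ext <| funext fun n => (hp n k a).symm
  refine ⟨A', inferInstance, inferInstance, g, σ, ?_, hcomplete, Subtype.ext <| funext hv,
    Subtype.ext <| funext hv', fun n b => ?_, fun n k a h => ?_, fun n T _ f hf hfs => ?_⟩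
  · exact Module.Flat.of_dense I ι hdense fun a n h => by rwa [← hq, hqι, hpker] at h
  · obtain ⟨x, hx⟩ := hdense b n
    obtain ⟨k, a, rfl⟩ := husurj x
    exact ⟨k, a, by rwa [hσ]⟩
  · rwa [hσ, ← hq, hqι, hpzero] at h
  · obtain ⟨F, hF⟩ := huniv n T f hf hfs
    refine ⟨F.comp ((Pi.evalRingHom B n).comp (A'.val : A' →+* ∀ n, B n)), hF, fun b hb => ?_⟩
    have h : q n b = 0 := (hq n b).2 hb
    exact (congrArg F h).trans (map_zero F)

end CompletedLocalization

section Lifting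

variable {R : Type u} [CommRing R] {A : Type u} [Ring A] [Algebra R A]

theorem mul_mem_mul_smul_top {I J : Ideal R} {x y : A} (hx : x ∈ I • (⊤ : Submodule R A))
    (hy : y ∈ J • (⊤ : Submodule R A)) : x * y ∈ (I * J) • (⊤ : Submodule R A) := by
  have h := Submodule.mem_map_of_mem (f := LinearMap.mulLeft R x) hy
  rw [Submodule.map_smul'', Submodule.map_top] at h
  rw [mul_comm, Submodule.mul_smul]
  refine Submodule.smul_mono le_rfl ?_ h
  rintro _ ⟨z, rfl⟩
  exact mem_smul_top_mul I z hx

theorem pow_mem_pow_smul_top {I : Ideal R} {x : A} (hx : x ∈ I • (⊤ : Submodule R A)) (n : ℕ) :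
    x ^ n ∈ I ^ n • (⊤ : Submodule R A) := by
  induction n with
  | zero => simp
  | succ n ih =>
    rw [pow_succ, pow_succ]
    exact mul_mem_mul_smul_top ih hx

/-- An element invertible modulo `I` is invertible modulo `I ^ n`. -/
theorem isUnit_mk_extendedIdeal_pow {I : Ideal R} {x y : A}
    (hxy : 1 - x * y ∈ I • (⊤ : Submodule R A)) (hyx : 1 - y * x ∈ I • (⊤ : Submodule R A))
    (n : ℕ) : IsUnit (Ideal.Quotient.mk (extendedIdeal A (I ^ n)) x) := by
  have key : ∀ z : A, 1 - z ∈ I • (⊤ : Submodule R A) →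
      IsUnit (Ideal.Quotient.mk (extendedIdeal A (I ^ n)) z) := fun z hz => by
    have hnil : IsNilpotent (Ideal.Quotient.mk (extendedIdeal A (I ^ n)) (1 - z)) :=
      ⟨n, by rw [← map_pow]; exact Ideal.Quotient.eq_zero_iff_mem.2 (pow_mem_pow_smul_top hz n)⟩
    simpa using hnil.isUnit_one_sub
  obtain ⟨a, ha⟩ := (key _ hxy).exists_right_inv
  obtain ⟨b, hb⟩ := (key _ hyx).exists_left_inv
  rw [map_mul] at ha hb
  exact isUnit_iff_exists_and_exists.2
    ⟨⟨_, by rwa [mul_assoc] at ha⟩, ⟨_, by rwa [← mul_assoc] at hb⟩⟩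

theorem eq_of_forall_mk_extendedIdeal_eq {I : Ideal R} [IsHausdorff I A] {x y : A}
    (h : ∀ n, Ideal.Quotient.mk (extendedIdeal A (I ^ n)) x = Ideal.Quotient.mk _ y) : x = y :=
  IsHausdorff.eq_iff_smodEq (I := I) |>.2 fun n =>
    SModEq.sub_mem.2 (Ideal.Quotient.eq.1 (h n))

/-- A compatible family of homomorphisms to the quotients of an adically complete algebra lifts
to the algebra. -/
theorem exists_algHom_of_compatible {I : Ideal R} [IsAdicComplete I A] {B : Type u} [Ring B]
    [Algebra R B] (G : ∀ n, B →ₐ[R] A ⧸ extendedIdeal A (I ^ n))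
    (hG : ∀ n b x, G (n + 1) b = Ideal.Quotient.mk _ x → G n b = Ideal.Quotient.mk _ x) :
    ∃ G' : B →ₐ[R] A, ∀ n b, Ideal.Quotient.mk _ (G' b) = G n b := by
  have hlim : ∀ b, ∃ x, ∀ n, Ideal.Quotient.mk _ x = G n b := by
    intro b
    choose x hx using fun n => Ideal.Quotient.mk_surjective (G n b)
    obtain ⟨L, hL⟩ := IsPrecomplete.prec' (I := I) x fun {m n} h => by
      refine ((AdicCompletion.isAdicCauchy_iff I A x).2 fun n => ?_) h
      rw [SModEq.sub_mem]
      exact Ideal.Quotient.eq.1 ((hx n).trans (hG n b _ (hx (n + 1)).symm))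
    refine ⟨L, fun n => ?_⟩
    rw [← hx n]
    exact (Ideal.Quotient.eq.2 (SModEq.sub_mem.1 (hL n))).symm
  choose F hF using hlim
  exact ⟨{
    toFun := F
    map_one' := eq_of_forall_mk_extendedIdeal_eq (I := I) fun n => by simp [hF]
    map_mul' := fun a b => eq_of_forall_mk_extendedIdeal_eq (I := I) fun n => by simp [hF]
    map_zero' := eq_of_forall_mk_extendedIdeal_eq (I := I) fun n => by simp [hF]
    map_add' := fun a b => eq_of_forall_mk_extendedIdeal_eq (I := I) fun n => by simp [hF]
    commutes' := fun r => eq_of_forall_mk_extendedIdeal_eq (I := I) fun n => by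
      rw [hF, AlgHom.commutes]; rfl }, fun n b => hF b n⟩

/-- Ring homomorphisms agreeing on a subring, and killing an ideal modulo which every element is
a left fraction over that subring, are equal. -/
theorem RingHom.ext_of_leftFractions {A B T : Type*} [Ring A] [Ring B] [Ring T] (g : A →+* B)
    {s : A} {σ : B} (hσ : g s * σ = 1) (hσ' : σ * g s = 1) {J : Set B}
    (hJ : ∀ b, ∃ k a, b - σ ^ k * g a ∈ J) {f₁ f₂ : B →+* T}
    (h : ∀ a, f₁ (g a) = f₂ (g a)) (h₁ : ∀ b ∈ J, f₁ b = 0) (h₂ : ∀ b ∈ J, f₂ b = 0) :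
    f₁ = f₂ := by
  have hs : f₁ σ = f₂ σ := by
    refine left_inv_eq_right_inv (a := f₁ (g s)) ?_ ?_
    · rw [← map_mul, hσ', map_one]
    · rw [h, ← map_mul, hσ, map_one]
  ext b
  obtain ⟨k, a, hb⟩ := hJ b
  have e₁ := h₁ _ hb
  have e₂ := h₂ _ hb
  rw [map_sub, sub_eq_zero] at e₁ e₂
  rw [e₁, e₂, map_mul, map_mul, map_pow, map_pow, hs, h]

end Lifting

/-- Let `K` be a field, `(R, 𝔪)` a parameter `K`-algebra, `C` a
commutative `K`-algebra, `A` an associative `R`-deformation of `C` (with surjective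
`K`-algebra augmentation `ψ : A → C` whose kernel is `𝔪A`), and `τ : C → C'` a principal
localization.  Then there exist an associative `R`-deformation `A'` of `C'` and an
`R`-algebra homomorphism `g : A → A'` lifting `τ`, with the following universal property:
for every commutative `K`-algebra `C''` with a `K`-algebra homomorphism `τ' : C' → C''`,
every associative `R`-deformation `A''` of `C''` and every `R`-algebra homomorphism
`h : A → A''` lifting `τ' ∘ τ`, there exists a unique `R`-algebra homomorphism
`g' : A' → A''` lifting `τ'` such that `h = g' ∘ g`. -/
theorem stmt_5
    (K : Type u) [Field K]
    (R : Type u) [CommRing R] [Algebra K R] [IsLocalRing R] [IsNoetherianRing R]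
    (hres : Function.Bijective (algebraMap K (IsLocalRing.ResidueField R)))
    [IsAdicComplete (IsLocalRing.maximalIdeal R) R]
    (C : Type u) [CommRing C] [Algebra K C]
    (A : Type u) [Ring A] [Algebra R A] [Algebra K A] [IsScalarTower K R A]
    [Module.Flat R A] [IsAdicComplete (IsLocalRing.maximalIdeal R) A]
    (ψ : A →ₐ[K] C) (hψsurj : Function.Surjective ψ)
    (hψker : ∀ x : A, ψ x = 0 ↔ x ∈ (IsLocalRing.maximalIdeal R) • (⊤ : Submodule R A))
    (C' : Type u) [CommRing C'] [Algebra K C'] [Algebra C C'] [IsScalarTower K C C']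
    (s : C) [IsLocalization.Away s C'] :
    ∃ (A' : Type u) (_ : Ring A') (_ : Algebra R A') (_ : Algebra K A')
        (_ : IsScalarTower K R A'),
      Module.Flat R A' ∧ IsAdicComplete (IsLocalRing.maximalIdeal R) A' ∧
      ∃ (ψ' : A' →ₐ[K] C') (g : A →ₐ[R] A'),
        Function.Surjective ψ' ∧
        (∀ x : A', ψ' x = 0 ↔
          x ∈ (IsLocalRing.maximalIdeal R) • (⊤ : Submodule R A')) ∧
        (∀ x : A, ψ' (g x) = algebraMap C C' (ψ x)) ∧
        -- the universal property
        (∀ (C'' : Type u) (_ : CommRing C'') (_ : Algebra K C'') (τ' : C' →ₐ[K] C'')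
            (A'' : Type u) (_ : Ring A'') (_ : Algebra R A'') (_ : Algebra K A'')
            (_ : IsScalarTower K R A''),
          Module.Flat R A'' → IsAdicComplete (IsLocalRing.maximalIdeal R) A'' →
          ∀ (ψ'' : A'' →ₐ[K] C''),
            Function.Surjective ψ'' →
            (∀ x : A'', ψ'' x = 0 ↔
              x ∈ (IsLocalRing.maximalIdeal R) • (⊤ : Submodule R A'')) →
            ∀ (h : A →ₐ[R] A''),
              (∀ x : A, ψ'' (h x) = τ' (algebraMap C C' (ψ x))) →
              ∃! g' : A' →ₐ[R] A'',
                (∀ y : A', ψ'' (g' y) = τ' (ψ' y)) ∧ g'.comp g = h) := by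
  set I := IsLocalRing.maximalIdeal R
  obtain ⟨s₀, rfl⟩ := hψsurj s
  have hcomm : ∀ a, s₀ * a - a * s₀ ∈ I • (⊤ : Submodule R A) := fun a => by
    rw [← hψker, map_sub, map_mul, map_mul, mul_comm, sub_self]
  obtain ⟨A', _, _, g, σ, hflat, hcomplete, hσ, hσ', hdense, hstrict, huniv⟩ :=
    exists_completed_localization I s₀ hcomm
  let _ : Algebra K A' := Algebra.compHom A' (algebraMap K R)
  have _ : IsScalarTower K R A' := IsScalarTower.of_algebraMap_eq fun _ => rfl
  obtain ⟨F, hF, hFker⟩ := huniv 1 C' ((algebraMap C C').comp (ψ : A →+* C))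
    (fun a ha => by
      rw [pow_one, ← hψker] at ha
      exact (congrArg (algebraMap C C') ha).trans (map_zero _))
    (IsLocalization.Away.algebraMap_isUnit (ψ s₀))
  replace hF : ∀ a, F (g a) = algebraMap C C' (ψ a) := hF
  rw [pow_one] at hFker
  have hdense₁ := hdense 1
  have hstrict₁ := hstrict 1
  rw [pow_one] at hdense₁ hstrict₁
  let ψ' : A' →ₐ[K] C' :=
    { F with
      commutes' := fun k => by
        change F (algebraMap R A' (algebraMap K R k)) = _
        rw [← g.commutes, hF, ← IsScalarTower.algebraMap_apply, AlgHom.commutes,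
          ← IsScalarTower.algebraMap_apply] }
  have hψ' : ∀ a, ψ' (g a) = algebraMap C C' (ψ a) := hF
  have hFσ : F σ * algebraMap C C' (ψ s₀) = 1 := by rw [← hF, ← map_mul, hσ', map_one]
  have hσpow : ∀ l, σ ^ l * g s₀ ^ l = 1 := fun l => by
    have hc : Commute σ (g s₀) := hσ'.trans hσ.symm
    rw [← hc.mul_pow, hσ', one_pow]
  refine ⟨A', inferInstance, inferInstance, inferInstance, inferInstance, hflat, hcomplete, ψ', g,
    fun c => ?_, fun b => ⟨fun hb => ?_, hFker b⟩, hψ', ?_⟩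
  · obtain ⟨k, x, hx⟩ := IsLocalization.Away.surj (ψ s₀) c
    obtain ⟨a, rfl⟩ := hψsurj x
    refine ⟨σ ^ k * g a, ?_⟩
    change F _ = c
    rw [map_mul, map_pow, hF, ← hx, mul_comm c, ← mul_assoc, ← mul_pow, hFσ, one_pow, one_mul]
  · obtain ⟨k, a, hba⟩ := hdense₁ b
    have h1 : F (b - σ ^ k * g a) = 0 := hFker _ hba
    have h2 : F b = 0 := hb
    have h3 : IsUnit (F σ) := .of_mul_eq_one _ hFσ
    rw [map_sub, h2, zero_sub, neg_eq_zero, map_mul, map_pow,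
      (h3.pow k).mul_right_eq_zero, hF,
      IsLocalization.map_eq_zero_iff (Submonoid.powers (ψ s₀))] at h1
    obtain ⟨⟨_, l, rfl⟩, hl⟩ := h1
    change ψ s₀ ^ l * ψ a = 0 at hl
    rw [← map_pow, ← map_mul, hψker] at hl
    have h4 : σ ^ k * g a = σ ^ (k + l) * g (s₀ ^ l * a) := by
      rw [pow_add, mul_assoc, map_mul, map_pow, ← mul_assoc (σ ^ l), hσpow, one_mul]
    rw [← sub_add_cancel b (σ ^ k * g a), h4]
    rw [h4] at hba
    exact add_mem hba (mul_mem_smul_top I _ (LinearMap.map_mem_smul_top I g.toLinearMap hl))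
  · intro C'' _ _ τ' A'' _ _ _ _ _ _ ψ'' hψ''surj hψ''ker h hh
    obtain ⟨y, hy⟩ := hψ''surj (τ' (F σ))
    have hψy : ψ'' y * ψ'' (h s₀) = 1 := by rw [hy, hh, ← map_mul, hFσ, map_one]
    have hunit : ∀ n, IsUnit (Ideal.Quotient.mk (extendedIdeal A'' (I ^ n)) (h s₀)) :=
      isUnit_mk_extendedIdeal_pow (y := y)
        (by rw [← hψ''ker, map_sub, map_one, map_mul, mul_comm, hψy, sub_self])
        (by rw [← hψ''ker, map_sub, map_one, map_mul, hψy, sub_self])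
    have hmk : ∀ n x, x ∈ I ^ n • (⊤ : Submodule R A'') →
        Ideal.Quotient.mk (extendedIdeal A'' (I ^ n)) x = 0 := fun n x hx =>
      Ideal.Quotient.eq_zero_iff_mem.2 hx
    choose G hG hGker using fun n => huniv n (A'' ⧸ extendedIdeal A'' (I ^ n))
      ((Ideal.Quotient.mk _).comp (h : A →+* A''))
      (fun a ha => hmk n _ (LinearMap.map_mem_smul_top _ h.toLinearMap ha)) (hunit n)
    replace hG : ∀ n a, G n (g a) = Ideal.Quotient.mk _ (h a) := hG
    let G' : ∀ n, A' →ₐ[R] A'' ⧸ extendedIdeal A'' (I ^ n) := fun n =>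
      { G n with
        commutes' := fun r => by
          change G n _ = _
          rw [← g.commutes, hG, h.commutes]
          rfl }
    have hle : ∀ n, extendedIdeal A'' (I ^ (n + 1)) ≤ extendedIdeal A'' (I ^ n) := fun n x hx =>
      (Submodule.smul_mono_left (Ideal.pow_le_pow_right n.le_succ) : _ ≤ _) hx
    have hle' : ∀ n, I ^ (n + 1) • (⊤ : Submodule R A') ≤ I ^ n • (⊤ : Submodule R A') := fun n =>
      Submodule.smul_mono_left (Ideal.pow_le_pow_right n.le_succ)
    have hGcompat : ∀ n, (Ideal.Quotient.factor (hle n)).comp (G (n + 1)) = G n := fun n =>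
      RingHom.ext_of_leftFractions (g : A →+* A') hσ hσ'
        (J := (I ^ (n + 1) • (⊤ : Submodule R A') : Submodule R A')) (hdense (n + 1))
        (fun a => (congrArg (Ideal.Quotient.factor (hle n)) (hG (n + 1) a)).trans (hG n a).symm)
        (fun b hb => (congrArg (Ideal.Quotient.factor (hle n)) (hGker (n + 1) b hb)).trans
          (map_zero _))
        (fun b hb => hGker n b (hle' n hb))
    obtain ⟨g', hg'⟩ := exists_algHom_of_compatible G' fun n b x hx => by
      have := congrArg (fun f => f b) (hGcompat n)
      exact this.symm.trans (congrArg (Ideal.Quotient.factor (hle n)) hx)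
    have hg'g : ∀ a, g' (g a) = h a := fun a =>
      eq_of_forall_mk_extendedIdeal_eq (I := I) fun n => (hg' n _).trans (hG n a)
    refine ⟨g', ⟨fun b => ?_, AlgHom.ext hg'g⟩, ?_⟩
    · refine congrArg (fun f => f b) (RingHom.ext_of_leftFractions (g : A →+* A') hσ hσ'
        (J := (I • (⊤ : Submodule R A') : Submodule R A')) hdense₁
        (f₁ := (ψ'' : A'' →+* C'').comp (g' : A' →+* A''))
        (f₂ := (τ' : C' →+* C'').comp F) (fun a => ?_) (fun z hz => ?_) (fun z hz => ?_))
      · change ψ'' (g' (g a)) = τ' (F (g a))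
        rw [hg'g, hh, hF]
      · exact (hψ''ker _).2 (LinearMap.map_mem_smul_top I g'.toLinearMap hz)
      · exact (congrArg τ' (hFker z hz)).trans (map_zero τ')
    · rintro f ⟨-, hfg⟩
      ext b
      refine eq_of_forall_mk_extendedIdeal_eq (I := I) fun n => ?_
      refine congrArg (fun f => f b) (RingHom.ext_of_leftFractions (g : A →+* A') hσ hσ'
        (J := (I ^ n • (⊤ : Submodule R A') : Submodule R A')) (hdense n)
        (f₁ := (Ideal.Quotient.mk _).comp (f : A' →+* A''))
        (f₂ := (Ideal.Quotient.mk _).comp (g' : A' →+* A'')) (fun a => ?_)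
        (fun z hz => hmk n _ (LinearMap.map_mem_smul_top _ f.toLinearMap hz))
        (fun z hz => hmk n _ (LinearMap.map_mem_smul_top _ g'.toLinearMap hz)))
      exact congrArg (Ideal.Quotient.mk _) ((congrArg (fun f => f a) hfg).trans (hg'g a).symm)
end
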